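/- arXiv:1712.09023 — 3 statements merged into one kernel-verified Lean document; each statement's English description precedes it below -/
import Mathlib

section
/- Let 1<p<∞, ω a Muckenhoupt A_p weight on ℝⁿ, and b ∈ BMO(ℝⁿ). Then there is a constant C such that ‖M_b f‖_{L^p(ω)} ≤ C ‖b‖_BMO ‖f‖_{L^p(ω)} for all f ∈ L^p(ω), where M_b f(x) = sup_{r>0} r^{−n} ∫_{|x−y|<r} |b(x)−b(y)| |f(y)| dy. -/
open MeasureTheory Metric Filter Set
open scoped ENNReal Topology

noncomputable section

abbrev Rn (n : ℕ) := EuclideanSpace ℝ (Fin n)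

/-- θ is a modulus of continuity as in the paper: continuous, increasing,
subadditive on `[0,1]`, nonnegative, with `θ 0 = 0`. -/
def IsModulus (θ : ℝ → ℝ) : Prop :=
  ContinuousOn θ (Icc 0 1) ∧ MonotoneOn θ (Icc 0 1) ∧
    (∀ s t : ℝ, 0 ≤ s → 0 ≤ t → s + t ≤ 1 → θ (s + t) ≤ θ s + θ t) ∧
    θ 0 = 0 ∧ ∀ t ∈ Icc (0:ℝ) 1, 0 ≤ θ t

/-- The Dini condition `∫₀¹ θ(t)/t dt < ∞`. -/
def DiniCondition (θ : ℝ → ℝ) : Prop :=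
  IntegrableOn (fun t => θ t / t) (Ioc (0:ℝ) 1)

/-- `K` is a θ-type kernel with size constant `C₀`. -/
def IsThetaKernel (n : ℕ) (θ : ℝ → ℝ) (C₀ : ℝ) (K : Rn n → Rn n → ℝ) : Prop :=
  (∀ x y : Rn n, x ≠ y → |K x y| ≤ C₀ / ‖x - y‖ ^ n) ∧
    ∀ x x' y : Rn n, x ≠ y → 2 * ‖x - x'‖ ≤ ‖x - y‖ →
      |K x y - K x' y| + |K y x - K y x'| ≤ θ (‖x - x'‖ / ‖x - y‖) / ‖x - y‖ ^ n

/-- The open cube centered at `c` with sidelength `r`. -/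
def cube {n : ℕ} (c : Rn n) (r : ℝ) : Set (Rn n) := {x | ∀ i, |x i - c i| < r / 2}

/-- `ω` is a Muckenhoupt `A_p` weight (over cubes). -/
def IsAp (n : ℕ) (p : ℝ) (ω : Rn n → ℝ) : Prop :=
  (∀ᵐ x : Rn n, 0 < ω x) ∧ LocallyIntegrable ω volume ∧
    ∃ A : ℝ≥0∞, A ≠ ⊤ ∧ ∀ (c : Rn n) (r : ℝ), 0 < r →
      ((∫⁻ x in cube c r, ENNReal.ofReal (ω x)) / ENNReal.ofReal (r ^ n)) *
        (((∫⁻ x in cube c r, ENNReal.ofReal (ω x ^ (1 - p / (p - 1)))) /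
          ENNReal.ofReal (r ^ n)) ^ (p - 1)) ≤ A

/-- The measure `ω(x) dx`. -/
def wMeasure (n : ℕ) (ω : Rn n → ℝ) : Measure (Rn n) :=
  (volume : Measure (Rn n)).withDensity fun x => ENNReal.ofReal (ω x)

/-- Hardy–Littlewood maximal function, `ℝ≥0∞`-valued. -/
def maximal {n : ℕ} (f : Rn n → ℝ) (x : Rn n) : ℝ≥0∞ :=
  ⨆ (r : ℝ) (_ : 0 < r),
    (volume (ball x r))⁻¹ * ∫⁻ y in ball x r, ENNReal.ofReal |f y|

/-- Mean oscillation of `b` over the ball `B(c,r)`. -/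
def oscBall {n : ℕ} (b : Rn n → ℝ) (c : Rn n) (r : ℝ) : ℝ :=
  ⨍ x in ball c r, |b x - ⨍ y in ball c r, b y|

/-- `b ∈ BMO(ℝⁿ)`. -/
def IsBMO {n : ℕ} (b : Rn n → ℝ) : Prop :=
  LocallyIntegrable b volume ∧ ∃ C : ℝ, ∀ c r, 0 < r → oscBall b c r ≤ C

/-- The BMO norm of `b`. -/
def bmoNorm {n : ℕ} (b : Rn n → ℝ) : ℝ :=
  ⨆ c : Rn n, ⨆ r : {r : ℝ // 0 < r}, oscBall b c r.1

/-- `b ∈ VMO(ℝⁿ)`: `b ∈ BMO` and its oscillation over balls of a fixed size tends to `0`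
both as the size tends to `0` and as it tends to `∞`. -/
def IsVMO {n : ℕ} (b : Rn n → ℝ) : Prop :=
  IsBMO b ∧
    Tendsto (fun r : ℝ => ⨆ c : Rn n, oscBall b c r) (𝓝[>] 0) (𝓝 0) ∧
    Tendsto (fun r : ℝ => ⨆ c : Rn n, oscBall b c r) atTop (𝓝 0)

/-- `T` is an operator, bounded on `L²`, associated with the kernel `K`:
for smooth compactly supported `f` and a.e. `x` outside the support of `f`,
`T f x = ∫ K x y * f y dy`. -/
def IsCZO (n : ℕ) (K : Rn n → Rn n → ℝ)
    (T : Lp ℝ 2 (volume : Measure (Rn n)) →L[ℝ] Lp ℝ 2 (volume : Measure (Rn n))) : Prop :=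
  ∀ (f : Rn n → ℝ) (hf : MemLp f 2 (volume : Measure (Rn n))),
    ContDiff ℝ (⊤ : ℕ∞) f → HasCompactSupport f →
      ∀ᵐ x : Rn n, x ∉ tsupport f → (T (hf.toLp f) : Rn n → ℝ) x = ∫ y, K x y * f y

/-- Properties of the smooth truncation function `ψ`. -/
def PsiCond (ψ : ℝ → ℝ) (C₁ : ℝ) : Prop :=
  (∀ t, 0 ≤ ψ t ∧ ψ t ≤ 1) ∧ (∀ t ≤ (1:ℝ)/2, ψ t = 0) ∧ (∀ t, 1 ≤ t → ψ t = 1) ∧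
    ∀ t ∈ Ioo ((1:ℝ)/2) 1, |deriv ψ t| ≤ C₁

/-- The maximal commutator `[b,T*] f (x)`. -/
def maxComm {n : ℕ} (K : Rn n → Rn n → ℝ) (b f : Rn n → ℝ) (x : Rn n) : ℝ≥0∞ :=
  ⨆ (ε : ℝ) (_ : 0 < ε),
    ENNReal.ofReal |∫ y in {y : Rn n | ε ≤ dist x y}, (b x - b y) * K x y * f y|

/-- The maximal truncated singular integral `T* f (x)`. -/
def truncT {n : ℕ} (K : Rn n → Rn n → ℝ) (f : Rn n → ℝ) (x : Rn n) : ℝ≥0∞ :=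
  ⨆ (ε : ℝ) (_ : 0 < ε),
    ENNReal.ofReal |∫ y in {y : Rn n | ε ≤ dist x y}, K x y * f y|

/-- Weighted `L^p` "norm" of an `ℝ≥0∞`-valued function. -/
def wLpNorm {n : ℕ} (p : ℝ) (μ : Measure (Rn n)) (g : Rn n → ℝ≥0∞) : ℝ≥0∞ :=
  (∫⁻ x, g x ^ p ∂μ) ^ (1 / p)

/-- `‖∇b‖_∞`. -/
def gradSup {n : ℕ} (b : Rn n → ℝ) : ℝ := ⨆ x : Rn n, ‖fderiv ℝ b x‖

/-- The maximal operator `M_b`. -/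
def Mb {n : ℕ} (b f : Rn n → ℝ) (x : Rn n) : ℝ≥0∞ :=
  ⨆ (r : ℝ) (_ : 0 < r),
    (ENNReal.ofReal (r ^ n))⁻¹ * ∫⁻ y in ball x r, ENNReal.ofReal (|b x - b y| * |f y|)


namespace S15

def vball (n : ℕ) (r : ℝ) : ℝ≥0∞ := volume (ball (0 : Rn n) r)

def Good {n : ℕ} (μ : Measure (Rn n)) : Prop :=
  μ ≪ volume ∧ (∀ x r, μ (ball x r) ≠ ⊤) ∧ ∃ q : ℝ, 0 < q ∧ ∃ K : ℝ≥0∞, K ≠ ⊤ ∧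
    ∀ x r, 0 < r → ∀ E, MeasurableSet E → E ⊆ ball x r →
      volume E ^ q * μ (ball x r) ≤ K * μ E * volume (ball x r) ^ q

lemma vol_pos {n : ℕ} (x : Rn n) {r : ℝ} (hr : 0 < r) : volume (ball x r) ≠ 0 :=
  (measure_ball_pos _ x hr).ne'

lemma vol_fin {n : ℕ} (x : Rn n) (r : ℝ) : volume (ball x r) ≠ ⊤ :=
  measure_ball_lt_top.ne

lemma vol_mul {n : ℕ} (x y : Rn n) {k r : ℝ} (hk : 0 < k) :
    volume (ball x (k * r)) = ENNReal.ofReal (k ^ n) * volume (ball y r) := by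
  rw [Measure.addHaar_ball_mul_of_pos volume x hk, Measure.addHaar_ball_center volume y]
  simp

lemma Good.doubling {n : ℕ} {μ : Measure (Rn n)} (h : Good μ) (k : ℝ) (hk : 1 ≤ k) :
    ∃ C : ℝ≥0∞, C ≠ ⊤ ∧ ∀ x r, 0 < r → μ (ball x (k * r)) ≤ C * μ (ball x r) := by
  obtain ⟨-, -, q, hq, K, hK, H⟩ := h
  refine ⟨K * ENNReal.ofReal (k ^ n) ^ q,
    ENNReal.mul_ne_top hK (ENNReal.rpow_ne_top_of_nonneg hq.le ENNReal.ofReal_ne_top), ?_⟩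
  intro x r hr
  have h1 := H x (k * r) (by positivity) (ball x r) measurableSet_ball
    (ball_subset_ball (by nlinarith))
  rw [vol_mul x x (by positivity), ENNReal.mul_rpow_of_nonneg _ _ hq.le] at h1
  have hv0 : volume (ball x r) ^ q ≠ 0 := by
    simp [ENNReal.rpow_eq_zero_iff, vol_pos x hr, hq.not_gt]
  have hvt : volume (ball x r) ^ q ≠ ⊤ := ENNReal.rpow_ne_top_of_nonneg hq.le (vol_fin x r)
  rw [← ENNReal.mul_le_mul_iff_right hv0 hvt]
  calc _ ≤ _ := h1
    _ = _ := by ring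

/-- Vitali-type covering lemma. -/
lemma Good.vitali {n : ℕ} {μ : Measure (Rn n)} (h : Good μ) :
    ∃ C : ℝ≥0∞, C ≠ ⊤ ∧ ∀ (ν : Measure (Rn n)) (T : Set (Rn n × ℝ)),
      (∀ a ∈ T, 0 < a.2) → (∀ a ∈ T, μ (ball a.1 a.2) ≤ ν (ball a.1 a.2)) →
      μ (⋃ a ∈ T, ball a.1 a.2) ≤ C * ν univ := by
  obtain ⟨C, hC, H⟩ := h.doubling 4 (by norm_num)
  refine ⟨C, hC, fun ν T hT hle => ?_⟩
  have key : ∀ N : ℕ, μ (⋃ a ∈ T ∩ {a | a.2 ≤ N}, ball a.1 a.2) ≤ C * ν univ := by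
    intro N
    obtain ⟨u, hu, hd, hcov⟩ := Vitali.exists_disjoint_subfamily_covering_enlargement_ball
      (T ∩ {a | a.2 ≤ N}) (fun a => a.1) (fun a => a.2) N (fun a ha => ha.2) 4 (by norm_num)
    have hc : u.Countable := hd.countable_of_isOpen (fun _ _ => isOpen_ball)
      (fun a ha => ⟨a.1, mem_ball_self (hT a (hu ha).1)⟩)
    calc _ ≤ μ (⋃ a ∈ u, ball a.1 (4 * a.2)) := by
          apply measure_mono
          apply iUnion₂_subset
          intro a ha
          obtain ⟨b, hb, hab⟩ := hcov a ha
          exact hab.trans (subset_biUnion_of_mem (u := fun a : Rn n × ℝ => ball a.1 (4 * a.2)) hb)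
      _ ≤ ∑' a : u, μ (ball a.1.1 (4 * a.1.2)) := measure_biUnion_le _ hc _
      _ ≤ ∑' a : u, C * ν (ball a.1.1 a.1.2) := by
          refine ENNReal.tsum_le_tsum fun a => (H _ _ (hT _ (hu a.2).1)).trans ?_
          exact mul_le_mul_right (hle _ (hu a.2).1) _
      _ = C * ν (⋃ a ∈ u, ball a.1 a.2) := by
          rw [ENNReal.tsum_mul_left, measure_biUnion hc hd (fun _ _ => measurableSet_ball)]
      _ ≤ _ := by gcongr; exact subset_univ _
  have : (⋃ a ∈ T, ball a.1 a.2) = ⋃ N : ℕ, ⋃ a ∈ T ∩ {a | a.2 ≤ N}, ball a.1 a.2 := by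
    ext x
    simp only [mem_iUnion, mem_inter_iff, mem_ofPred_eq, exists_prop]
    constructor
    · rintro ⟨a, ha, hx⟩
      obtain ⟨N, hN⟩ := exists_nat_ge a.2
      exact ⟨N, a, ⟨ha, hN⟩, hx⟩
    · rintro ⟨N, a, ⟨ha, -⟩, hx⟩
      exact ⟨a, ha, hx⟩
  rw [this, Monotone.measure_iUnion]
  · exact iSup_le key
  · intro N M hNM
    apply biUnion_subset_biUnion_left
    rintro a ⟨ha, h2⟩
    exact ⟨ha, le_trans (b := (N : ℝ)) h2 (Nat.cast_le.2 hNM)⟩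

/-- uncentered maximal function with respect to a measure -/
def mx {n : ℕ} (μ : Measure (Rn n)) (f : Rn n → ℝ≥0∞) (x : Rn n) : ℝ≥0∞ :=
  ⨆ (a : Rn n × ℝ) (_ : 0 < a.2 ∧ x ∈ ball a.1 a.2),
    (∫⁻ y in ball a.1 a.2, f y ∂μ) / μ (ball a.1 a.2)

lemma mx_level {n : ℕ} (μ : Measure (Rn n)) (f : Rn n → ℝ≥0∞) (t : ℝ≥0∞) :
    {x | t < mx μ f x} = ⋃ a ∈ {a : Rn n × ℝ | 0 < a.2 ∧
      t < (∫⁻ y in ball a.1 a.2, f y ∂μ) / μ (ball a.1 a.2)}, ball a.1 a.2 := by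
  ext x
  simp only [mx, mem_ofPred_eq, lt_iSup_iff, mem_iUnion, exists_prop]
  constructor
  · rintro ⟨a, ⟨h1, h2⟩, h3⟩; exact ⟨a, ⟨h1, h3⟩, h2⟩
  · rintro ⟨a, ⟨h1, h2⟩, h3⟩; exact ⟨a, ⟨h1, h3⟩, h2⟩

lemma mx_meas {n : ℕ} (μ : Measure (Rn n)) (f : Rn n → ℝ≥0∞) : Measurable (mx μ f) := by
  apply measurable_of_Ioi
  intro t
  have : mx μ f ⁻¹' Ioi t = {x | t < mx μ f x} := rfl
  rw [this, mx_level]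
  exact (isOpen_biUnion fun _ _ => isOpen_ball).measurableSet

lemma Good.weak {n : ℕ} {μ : Measure (Rn n)} (h : Good μ) :
    ∃ C : ℝ≥0∞, C ≠ ⊤ ∧ ∀ f : Rn n → ℝ≥0∞, ∀ t : ℝ≥0∞, t ≠ 0 → t ≠ ⊤ →
      t * μ {x | t < mx μ f x} ≤ C * ∫⁻ x, f x ∂μ := by
  obtain ⟨C, hC, H⟩ := h.vitali
  refine ⟨C, hC, fun f t ht0 htt => ?_⟩
  have := H (t⁻¹ • μ.withDensity f) {a : Rn n × ℝ | 0 < a.2 ∧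
      t < (∫⁻ y in ball a.1 a.2, f y ∂μ) / μ (ball a.1 a.2)} (fun a ha => ha.1) (by
    rintro a ⟨ha, h2⟩
    rw [Measure.smul_apply, withDensity_apply _ measurableSet_ball, smul_eq_mul]
    have := ENNReal.mul_le_of_le_div h2.le
    rw [← ENNReal.mul_le_mul_iff_right ht0 htt, ← mul_assoc, ENNReal.mul_inv_cancel ht0 htt,
      one_mul]
    exact this)
  rw [mx_level]
  calc _ ≤ t * (C * (t⁻¹ • μ.withDensity f) univ) := mul_le_mul_right this t
    _ = (t * t⁻¹) * (C * ∫⁻ x, f x ∂μ) := by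
      rw [Measure.smul_apply, withDensity_apply _ MeasurableSet.univ, smul_eq_mul,
        Measure.restrict_univ]; ring
    _ = _ := by rw [ENNReal.mul_inv_cancel ht0 htt, one_mul]

lemma mx_split {n : ℕ} (μ : Measure (Rn n)) (f g : Rn n → ℝ≥0∞) (s : ℝ≥0∞) (hg : Measurable g)
    (hfg : ∀ x, f x ≤ g x + s) (x) : mx μ f x ≤ mx μ g x + s := by
  apply iSup₂_le
  intro a ha
  calc _ ≤ (∫⁻ y in ball a.1 a.2, (g y + s) ∂μ) / μ (ball a.1 a.2) := by
        gcongr; exact hfg _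
    _ = (∫⁻ y in ball a.1 a.2, g y ∂μ) / μ (ball a.1 a.2) +
          s * μ (ball a.1 a.2) / μ (ball a.1 a.2) := by
        rw [lintegral_add_left hg, setLIntegral_const, ENNReal.add_div]
    _ ≤ _ := by
        gcongr
        · exact le_iSup₂ (f := fun (a : Rn n × ℝ) (_ : 0 < a.2 ∧ x ∈ ball a.1 a.2) =>
            (∫⁻ y in ball a.1 a.2, g y ∂μ) / μ (ball a.1 a.2)) a ha
        · exact ENNReal.div_le_of_le_mul le_rfl


lemma two_z (k : ℤ) : (2 : ℝ≥0∞) ^ k ≠ 0 ∧ (2 : ℝ≥0∞) ^ k ≠ ⊤ :=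
  ⟨(ENNReal.zpow_pos (by norm_num) (by norm_num) k).ne', ENNReal.zpow_ne_top (by norm_num) (by norm_num) k⟩

lemma two_add (k m : ℤ) : (2 : ℝ≥0∞) ^ (k + m) = 2 ^ k * 2 ^ m :=
  ENNReal.zpow_add (by norm_num) (by norm_num) k m

lemma two_mono {k m : ℤ} (h : k ≤ m) : (2 : ℝ≥0∞) ^ k ≤ 2 ^ m :=
  ENNReal.zpow_le_of_le (by norm_num) h

lemma pow_le_sum (q : ℝ) (hq : 0 < q) (y : ℝ≥0∞) :
    y ^ q ≤ ∑' k : ℤ, (if (2 : ℝ≥0∞) ^ (k + 1) < y then ((2 : ℝ≥0∞) ^ (k + 2)) ^ q else 0) := by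
  by_cases h0 : y = 0
  · simp [h0, hq]
  by_cases ht : y = ⊤
  · subst ht
    have h1 : ∀ k : ℤ, ((2 : ℝ≥0∞) ^ (k + 1) < ⊤) := fun k => (two_z _).2.lt_top
    simp only [h1, if_true]
    have : ∑' k : ℕ, (1 : ℝ≥0∞) = ⊤ := ENNReal.tsum_const_eq_top_of_ne_zero one_ne_zero
    rw [ENNReal.top_rpow_of_pos hq, ← this]
    calc _ ≤ ∑' k : ℕ, ((2 : ℝ≥0∞) ^ ((k : ℤ) + 2)) ^ q := by
          apply ENNReal.tsum_le_tsum
          intro k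
          apply ENNReal.one_le_rpow _ hq
          simpa using two_mono (k := 0) (m := k + 2) (by positivity)
      _ ≤ _ := ENNReal.tsum_comp_le_tsum_of_injective (f := fun k : ℕ => (k : ℤ))
          Nat.cast_injective (fun k : ℤ => ((2 : ℝ≥0∞) ^ (k + 2)) ^ q)
  · obtain ⟨m, hm⟩ := ENNReal.exists_mem_Ioc_zpow (x := y) (y := 2) h0 ht (by norm_num) (by norm_num)
    refine le_trans ?_ (ENNReal.le_tsum (m - 1))
    rw [show m - 1 + 1 = m by ring, show m - 1 + 2 = m + 1 by ring, if_pos hm.1]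
    exact ENNReal.rpow_le_rpow hm.2 hq.le

lemma sum_le_pow (s : ℝ) (hs : 0 < s) : ∃ C : ℝ≥0∞, C ≠ ⊤ ∧ ∀ y : ℝ≥0∞,
    ∑' k : ℤ, (if (2 : ℝ≥0∞) ^ k < y then ((2 : ℝ≥0∞) ^ k) ^ s else 0) ≤ C * y ^ s := by
  refine ⟨(1 - (2 : ℝ≥0∞)⁻¹ ^ s)⁻¹, ?_, ?_⟩
  · rw [Ne, ENNReal.inv_eq_top]
    apply (tsub_pos_of_lt _).ne'
    exact ENNReal.rpow_lt_one (by norm_num) hs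
  intro y
  by_cases h0 : y = 0
  · simp [h0]
  by_cases ht : y = ⊤
  · subst ht
    rw [ENNReal.top_rpow_of_pos hs, ENNReal.mul_top]
    · exact le_top
    · rw [Ne, ENNReal.inv_eq_zero]
      exact (tsub_le_self.trans_lt ENNReal.one_lt_top).ne
  obtain ⟨m, hm⟩ := ENNReal.exists_mem_Ioc_zpow (x := y) (y := 2) h0 ht (by norm_num) (by norm_num)
  have hle : ∀ k : ℤ, (2 : ℝ≥0∞) ^ k < y → k ≤ m := by
    intro k hk
    by_contra hlt
    push Not at hlt
    exact absurd (hk.trans_le hm.2) (not_lt.2 (two_mono (by omega)))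
  calc _ ≤ ∑' j : ℕ, ((2 : ℝ≥0∞) ^ m) ^ s * ((2 : ℝ≥0∞)⁻¹ ^ s) ^ j := by
        rw [← tsum_subtype_eq_of_support_subset (s := {k : ℤ | k ≤ m})]
        · let e : ℕ ≃ {k : ℤ | k ≤ m} :=
            { toFun := fun j => ⟨m - j, by simp⟩
              invFun := fun k => (m - k.1).toNat
              left_inv := fun j => by simp
              right_inv := fun k => by
                have := k.2
                ext
                simp only [mem_ofPred_eq] at this
                simp [this] }
          rw [← e.tsum_eq]
          apply ENNReal.tsum_le_tsum
          intro j
          have : ((2 : ℝ≥0∞) ^ (m - (j : ℤ))) ^ s = ((2 : ℝ≥0∞) ^ m) ^ s * ((2 : ℝ≥0∞)⁻¹ ^ s) ^ j := by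
            rw [sub_eq_add_neg, two_add, ENNReal.mul_rpow_of_nonneg _ _ hs.le, ENNReal.zpow_neg,
              zpow_natCast, ENNReal.inv_pow, ← ENNReal.rpow_natCast, ← ENNReal.rpow_natCast,
              ← ENNReal.rpow_mul, ← ENNReal.rpow_mul, mul_comm s]
          rw [← this]
          show (if _ then _ else _) ≤ _
          split_ifs
          · exact le_rfl
          · exact zero_le
        · intro k hk
          apply hle
          by_contra h
          simp [h] at hk
    _ = ((2 : ℝ≥0∞) ^ m) ^ s * (1 - (2 : ℝ≥0∞)⁻¹ ^ s)⁻¹ := by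
        rw [ENNReal.tsum_mul_left, ENNReal.tsum_geometric]
    _ ≤ _ := by
        rw [mul_comm]
        gcongr
        exact hm.1.le

lemma Good.strong {n : ℕ} {μ : Measure (Rn n)} (h : Good μ) (q : ℝ) (hq : 1 < q) :
    ∃ C : ℝ≥0∞, C ≠ ⊤ ∧ ∀ f : Rn n → ℝ≥0∞, Measurable f →
      ∫⁻ x, mx μ f x ^ q ∂μ ≤ C * ∫⁻ x, f x ^ q ∂μ := by
  obtain ⟨C, hC, H⟩ := h.weak
  obtain ⟨C', hC', H'⟩ := sum_le_pow (q - 1) (by linarith)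
  have hq0 : 0 < q := by linarith
  refine ⟨4 ^ q * C * C', by finiteness, ?_⟩
  intro f hf
  have step : ∀ k : ℤ, μ {x | (2 : ℝ≥0∞) ^ (k + 1) < mx μ f x} ≤
      ((2 : ℝ≥0∞) ^ k)⁻¹ * (C * ∫⁻ x, (if (2 : ℝ≥0∞) ^ k < f x then f x else 0) ∂μ) := by
    intro k
    obtain ⟨h0, ht⟩ := two_z k
    rw [← ENNReal.mul_le_mul_iff_right h0 ht, ← mul_assoc, ENNReal.mul_inv_cancel h0 ht, one_mul]
    refine le_trans ?_ (H _ ((2 : ℝ≥0∞) ^ k) h0 ht)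
    refine mul_le_mul_right (measure_mono ?_) _
    intro x hx
    rw [mem_ofPred_eq] at hx ⊢
    have hm : Measurable (fun x => if (2 : ℝ≥0∞) ^ k < f x then f x else 0) :=
      Measurable.ite (measurableSet_lt measurable_const hf) hf measurable_const
    have := hx.trans_le (mx_split μ f _ ((2 : ℝ≥0∞) ^ k) hm (fun x => by
      split_ifs with h
      · exact le_self_add
      · simpa using h) _)
    rw [two_add, zpow_one, mul_two] at this
    exact lt_of_add_lt_add_right this
  calc ∫⁻ x, mx μ f x ^ q ∂μ
      ≤ ∫⁻ x, ∑' k : ℤ, (if (2 : ℝ≥0∞) ^ (k + 1) < mx μ f x then ((2 : ℝ≥0∞) ^ (k + 2)) ^ q else 0) ∂μ :=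
        lintegral_mono fun x => pow_le_sum q hq0 _
    _ = ∑' k : ℤ, ((2 : ℝ≥0∞) ^ (k + 2)) ^ q * μ {x | (2 : ℝ≥0∞) ^ (k + 1) < mx μ f x} := by
        have hms : ∀ k : ℤ, MeasurableSet {x | (2 : ℝ≥0∞) ^ (k + 1) < mx μ f x} := fun k =>
          measurableSet_lt measurable_const (mx_meas μ f)
        rw [lintegral_tsum]
        · congr 1
          ext k
          rw [← lintegral_indicator_const (hms k)]
          congr 1
          ext x
          simp [indicator_apply]
        · intro k
          exact (Measurable.ite (hms k) measurable_const measurable_const).aemeasurable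
    _ ≤ ∑' k : ℤ, (4 ^ q * C) * ∫⁻ x, f x * (if (2 : ℝ≥0∞) ^ k < f x then ((2 : ℝ≥0∞) ^ k) ^ (q - 1) else 0) ∂μ := by
        apply ENNReal.tsum_le_tsum
        intro k
        obtain ⟨h0, ht⟩ := two_z k
        calc _ ≤ _ := mul_le_mul_right (step k) _
          _ = (4 ^ q * C) * (((2 : ℝ≥0∞) ^ k) ^ (q - 1) * ∫⁻ x, (if (2 : ℝ≥0∞) ^ k < f x then f x else 0) ∂μ) := by
            rw [two_add, ENNReal.mul_rpow_of_nonneg _ _ hq0.le, ENNReal.rpow_sub _ _ h0 ht,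
              ENNReal.rpow_one, div_eq_mul_inv, show (2 : ℝ≥0∞) ^ (2 : ℤ) = 4 by norm_num [← zpow_natCast]]
            ring
          _ = _ := by
            rw [← lintegral_const_mul' _ _ (by finiteness)]
            congr 2
            ext x
            split_ifs <;> simp [mul_comm]
    _ = (4 ^ q * C) * ∫⁻ x, f x * ∑' k : ℤ, (if (2 : ℝ≥0∞) ^ k < f x then ((2 : ℝ≥0∞) ^ k) ^ (q - 1) else 0) ∂μ := by
        rw [ENNReal.tsum_mul_left, ← lintegral_tsum]
        · simp_rw [ENNReal.tsum_mul_left]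
        · intro k
          exact (hf.mul (Measurable.ite (measurableSet_lt measurable_const hf)
            measurable_const measurable_const)).aemeasurable
    _ ≤ (4 ^ q * C) * ∫⁻ x, C' * f x ^ q ∂μ := by
        refine mul_le_mul_right (lintegral_mono fun x => ?_) _
        calc _ ≤ f x * (C' * f x ^ (q - 1)) := mul_le_mul_right (H' _) _
          _ = C' * (f x ^ (1 : ℝ) * f x ^ (q - 1)) := by rw [ENNReal.rpow_one]; ring
          _ = _ := by
            rw [← ENNReal.rpow_add_of_nonneg _ _ (by norm_num) (by linarith)]; congr 2; ring
    _ = _ := by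
        rw [lintegral_const_mul' _ _ hC']; ring


structure ApPair {n : ℕ} (p : ℝ) (A : ℝ≥0∞) (w s : Rn n → ℝ≥0∞) : Prop where
  hp : 1 < p
  hA : A ≠ ⊤
  hw : Measurable w
  hs : Measurable s
  w0 : ∀ x, w x ≠ 0
  wt : ∀ x, w x ≠ ⊤
  rel : ∀ x, s x = w x ^ (-(1 / (p - 1)))
  ap : ∀ x r, 0 < r → (∫⁻ y in ball x r, w y) * (∫⁻ y in ball x r, s y) ^ (p - 1) ≤
    A * volume (ball x r) ^ p

variable {n : ℕ} {p : ℝ} {A : ℝ≥0∞} {w s : Rn n → ℝ≥0∞}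

lemma ApPair.s0 (h : ApPair p A w s) (x) : s x ≠ 0 := by
  rw [h.rel]
  exact (ENNReal.rpow_pos (pos_iff_ne_zero.2 (h.w0 x)) (h.wt x)).ne'

lemma ApPair.st (h : ApPair p A w s) (x) : s x ≠ ⊤ := by
  rw [h.rel]
  exact ENNReal.rpow_ne_top_of_ne_zero (h.w0 x) (h.wt x)

lemma ApPair.rel' (h : ApPair p A w s) (x) : w x = s x ^ (-(p - 1)) := by
  have := h.hp
  rw [h.rel, ← ENNReal.rpow_mul, show -(1 / (p - 1)) * -(p - 1) = 1 by
    have : p - 1 ≠ 0 := by linarith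
    field_simp, ENNReal.rpow_one]

lemma int_pos {f : Rn n → ℝ≥0∞} (hf : Measurable f) (h0 : ∀ x, f x ≠ 0) (x) {r : ℝ} (hr : 0 < r) :
    (∫⁻ y in ball x r, f y) ≠ 0 := by
  apply ((setLIntegral_pos_iff hf).2 _).ne'
  have : Function.support f = univ := by ext x; simp [h0]
  rw [this, univ_inter]
  exact measure_ball_pos _ x hr

lemma ApPair.symm (h : ApPair p A w s) : ApPair (p / (p - 1)) (A ^ (1 / (p - 1))) s w where
  hp := by
    have := h.hp
    rw [lt_div_iff₀] <;> linarith
  hA := ENNReal.rpow_ne_top_of_nonneg (by have := h.hp; exact div_nonneg zero_le_one (by linarith)) h.hA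
  hw := h.hs
  hs := h.hw
  w0 := h.s0
  wt := h.st
  rel := by
    intro x
    have := h.hp
    rw [h.rel']
    congr 1
    have : p - 1 ≠ 0 := by linarith
    field_simp
    ring
  ap := by
    intro x r hr
    have hp := h.hp
    have h1 := ENNReal.rpow_le_rpow (h.ap x r hr) (z := 1 / (p - 1))
      (div_nonneg zero_le_one (by linarith))
    have e : p - 1 ≠ 0 := by linarith
    have e0 : 0 ≤ 1 / (p - 1) := div_nonneg zero_le_one (by linarith)
    rw [ENNReal.mul_rpow_of_nonneg _ _ e0, ENNReal.mul_rpow_of_nonneg _ _ e0, ← ENNReal.rpow_mul,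
      ← ENNReal.rpow_mul, mul_one_div_cancel e, ENNReal.rpow_one, mul_comm] at h1
    rw [show p / (p - 1) - 1 = 1 / (p - 1) by field_simp; ring, show p / (p - 1) = p * (1 / (p - 1)) by ring]
    exact h1

lemma ApPair.finw (h : ApPair p A w s) (x) (r : ℝ) : (∫⁻ y in ball x r, w y) ≠ ⊤ := by
  rcases le_or_gt r 0 with hr | hr
  · simp [ball_eq_empty.2 hr]
  intro ht
  have hp := h.hp
  have h1 := h.ap x r hr
  rw [ht, ENNReal.top_mul] at h1
  · exact absurd (top_le_iff.1 h1) (ENNReal.mul_ne_top h.hA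
      (ENNReal.rpow_ne_top_of_nonneg (by linarith) (vol_fin x r)))
  · rw [Ne, ENNReal.rpow_eq_zero_iff_of_pos (by linarith)]
    exact int_pos h.hs h.s0 x hr

lemma ApPair.good (h : ApPair p A w s) : Good (volume.withDensity w) := by
  have hp := h.hp
  have hp0 : 0 < p := by linarith
  refine ⟨withDensity_absolutelyContinuous _ _, fun x r => ?_, p, hp0, A, h.hA, ?_⟩
  · rw [withDensity_apply _ measurableSet_ball]
    exact h.finw x r
  intro x r hr E hE hEB
  rw [withDensity_apply _ measurableSet_ball, withDensity_apply _ hE]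
  have hc : p.HolderConjugate (p / (p - 1)) := Real.HolderConjugate.conjExponent hp
  have h1 := ENNReal.lintegral_mul_le_Lp_mul_Lq (volume.restrict E) hc
    (f := fun x => w x ^ (1 / p)) (g := fun x => s x ^ ((p - 1) / p))
    (h.hw.pow_const _).aemeasurable (h.hs.pow_const _).aemeasurable
  have e1 : ∀ x, w x ^ (1 / p) * s x ^ ((p - 1) / p) = 1 := by
    intro x
    rw [h.rel, ← ENNReal.rpow_mul, ← ENNReal.rpow_add _ _ (h.w0 x) (h.wt x)]
    have : p - 1 ≠ 0 := by linarith
    rw [show 1 / p + -(1 / (p - 1)) * ((p - 1) / p) = 0 by field_simp; ring, ENNReal.rpow_zero]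
  have e2 : ∀ x, (w x ^ (1 / p)) ^ p = w x := by
    intro x
    rw [← ENNReal.rpow_mul, one_div_mul_cancel hp0.ne', ENNReal.rpow_one]
  have e3 : ∀ x, (s x ^ ((p - 1) / p)) ^ (p / (p - 1)) = s x := by
    intro x
    have : p - 1 ≠ 0 := by linarith
    rw [← ENNReal.rpow_mul, show (p - 1) / p * (p / (p - 1)) = 1 by field_simp, ENNReal.rpow_one]
  simp only [Pi.mul_apply, e1, e2, e3, setLIntegral_const, one_mul] at h1
  have h2 := ENNReal.rpow_le_rpow h1 hp0.le
  rw [ENNReal.mul_rpow_of_nonneg _ _ hp0.le, ← ENNReal.rpow_mul, ← ENNReal.rpow_mul,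
    one_div_mul_cancel hp0.ne', ENNReal.rpow_one, show 1 / (p / (p - 1)) * p = p - 1 by
      have : p - 1 ≠ 0 := by linarith
      field_simp] at h2
  calc volume E ^ p * ∫⁻ y in ball x r, w y
      ≤ (∫⁻ y in E, w y) * (∫⁻ y in ball x r, s y) ^ (p - 1) * ∫⁻ y in ball x r, w y := by
        refine mul_le_mul_left (h2.trans ?_) _
        refine mul_le_mul_right (ENNReal.rpow_le_rpow (lintegral_mono_set hEB) (by linarith)) _
    _ = (∫⁻ y in E, w y) * ((∫⁻ y in ball x r, w y) * (∫⁻ y in ball x r, s y) ^ (p - 1)) := by ring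
    _ ≤ (∫⁻ y in E, w y) * (A * volume (ball x r) ^ p) := mul_le_mul_right (h.ap x r hr) _
    _ = _ := by ring

lemma le_mx (μ : Measure (Rn n)) (f : Rn n → ℝ≥0∞) {c y : Rn n} {r : ℝ} (hr : 0 < r)
    (hy : y ∈ ball c r) : (∫⁻ y in ball c r, f y ∂μ) / μ (ball c r) ≤ mx μ f y :=
  le_iSup₂ (f := fun (a : Rn n × ℝ) (_ : 0 < a.2 ∧ y ∈ ball a.1 a.2) =>
            (∫⁻ y in ball a.1 a.2, f y ∂μ) / μ (ball a.1 a.2)) (c, r) ⟨hr, hy⟩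

lemma int_le_mx {f w : Rn n → ℝ≥0∞} (hw : Measurable w)
    (w0 : ∀ x, w x ≠ 0) (wt : ∀ x, w x ≠ ⊤)
    {c y : Rn n} {r : ℝ} (hfin : (∫⁻ y in ball c r, w y) ≠ ⊤) (hr : 0 < r) (hy : y ∈ ball c r)
    (hf : Measurable f) :
    (∫⁻ y in ball c r, f y) ≤
      (∫⁻ y in ball c r, w y) * mx (volume.withDensity w) (fun x => f x / w x) y := by
  have h1 := le_mx (volume.withDensity w) (fun x => f x / w x) hr hy
  rw [withDensity_apply _ measurableSet_ball,
    setLIntegral_withDensity_eq_setLIntegral_mul (g := fun x => f x / w x) _ hw (hf.div hw) measurableSet_ball] at h1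
  have : ∀ y, (w * fun x => f x / w x) y = f y := by
    intro y
    simp only [Pi.mul_apply]
    rw [ENNReal.mul_div_cancel (w0 y) (wt y)]
  simp_rw [this] at h1
  rw [ENNReal.div_le_iff (int_pos hw w0 c hr) hfin, mul_comm] at h1
  exact h1

lemma ApPair.muckenhoupt (h : ApPair p A w s) : ∃ C : ℝ≥0∞, C ≠ ⊤ ∧
    ∀ f : Rn n → ℝ≥0∞, Measurable f →
      ∫⁻ x, mx volume f x ^ p * w x ≤ C * ∫⁻ x, f x ^ p * w x := by
  have hp := h.hp
  have hp0 : 0 < p := by linarith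
  have hp1 : 0 < p - 1 := by linarith
  obtain ⟨C1, hC1, H1⟩ := h.good.strong (p / (p - 1)) h.symm.hp
  obtain ⟨C2, hC2, H2⟩ := h.symm.good.strong p hp
  refine ⟨A ^ (p / (p - 1)) * (C1 * C2), ?_, ?_⟩
  · exact ENNReal.mul_ne_top (ENNReal.rpow_ne_top_of_nonneg (by positivity) h.hA)
      (ENNReal.mul_ne_top hC1 hC2)
  intro f hf
  set F := mx (volume.withDensity s) (fun x => f x / s x) with hF
  have hFm : Measurable F := mx_meas _ _
  set G := mx (volume.withDensity w) (fun x => F x ^ (p - 1) / w x) with hG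
  have hGm : Measurable G := mx_meas _ _
  have key : ∀ x, mx volume f x ^ (p - 1) ≤ A * G x := by
    intro x
    rw [← ENNReal.le_rpow_inv_iff hp1]
    refine iSup₂_le ?_
    rintro ⟨c, r⟩ ⟨hr, hx⟩
    simp only at hr hx ⊢
    rw [ENNReal.le_rpow_inv_iff hp1]
    set B := ball c r with hB
    have v0 : volume B ≠ 0 := vol_pos c hr
    have vt : volume B ≠ ⊤ := vol_fin c r
    have k1 : (∫⁻ y in B, f y) ^ (p - 1) * volume B ≤
        (∫⁻ y in B, s y) ^ (p - 1) * ∫⁻ y in B, F y ^ (p - 1) := by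
      rw [← setLIntegral_const, ← lintegral_const_mul _ (hFm.pow_const _)]
      refine setLIntegral_mono' measurableSet_ball fun y hy => ?_
      rw [← ENNReal.mul_rpow_of_nonneg _ _ hp1.le]
      exact ENNReal.rpow_le_rpow (int_le_mx h.hs h.s0 h.st (h.symm.finw c r) hr hy hf) hp1.le
    have k2 := int_le_mx h.hw h.w0 h.wt (h.finw c r) hr hx (hFm.pow_const (p - 1))
    have k3 : (∫⁻ y in B, f y) ^ (p - 1) * volume B ≤ A * G x * volume B ^ p :=
      calc _ ≤ _ := k1
        _ ≤ _ := mul_le_mul_right k2 _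
        _ = ((∫⁻ y in B, w y) * (∫⁻ y in B, s y) ^ (p - 1)) * G x := by ring
        _ ≤ _ := mul_le_mul_left (h.ap c r hr) _
        _ = _ := by ring
    rw [show p = (p - 1) + 1 by ring, ENNReal.rpow_add _ _ v0 vt, ENNReal.rpow_one, ← mul_assoc,
      ENNReal.mul_le_mul_iff_left v0 vt] at k3
    rw [ENNReal.div_rpow_of_nonneg _ _ hp1.le]
    apply ENNReal.div_le_of_le_mul
    convert k3 using 3
    ring
  have hpp : ∀ x, mx volume f x ^ p ≤ A ^ (p / (p - 1)) * G x ^ (p / (p - 1)) := by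
    intro x
    rw [← ENNReal.mul_rpow_of_nonneg _ _ (by positivity)]
    refine le_trans (le_of_eq ?_) (ENNReal.rpow_le_rpow (key x) (by positivity))
    rw [← ENNReal.rpow_mul]
    congr 1
    field_simp
  calc ∫⁻ x, mx volume f x ^ p * w x
      ≤ ∫⁻ x, A ^ (p / (p - 1)) * (w x * G x ^ (p / (p - 1))) := by
        refine lintegral_mono fun x => ?_
        calc _ ≤ _ := mul_le_mul_left (hpp x) _
          _ = _ := by ring
    _ = A ^ (p / (p - 1)) * ∫⁻ x, G x ^ (p / (p - 1)) ∂(volume.withDensity w) := by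
        rw [lintegral_withDensity_eq_lintegral_mul _ h.hw (hGm.pow_const _)]
        exact lintegral_const_mul _ (h.hw.mul (hGm.pow_const _))
    _ ≤ A ^ (p / (p - 1)) * (C1 * ∫⁻ x, (F x ^ (p - 1) / w x) ^ (p / (p - 1)) ∂(volume.withDensity w)) :=
        mul_le_mul_right (H1 _ ((hFm.pow_const _).div h.hw)) _
    _ = A ^ (p / (p - 1)) * (C1 * ∫⁻ x, F x ^ p ∂(volume.withDensity s)) := by
        congr 2
        rw [lintegral_withDensity_eq_lintegral_mul (g := fun x => (F x ^ (p - 1) / w x) ^ (p / (p - 1))) _ h.hw (((hFm.pow_const _).div h.hw).pow_const _),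
          lintegral_withDensity_eq_lintegral_mul _ h.hs (hFm.pow_const _)]
        refine lintegral_congr fun x => ?_
        simp only [Pi.mul_apply]
        rw [ENNReal.div_rpow_of_nonneg _ _ (by positivity), ← ENNReal.rpow_mul,
          show (p - 1) * (p / (p - 1)) = p by field_simp, div_eq_mul_inv, ← ENNReal.rpow_neg, h.rel,
          mul_left_comm, mul_comm]
        congr 1
        nth_rw 1 [← ENNReal.rpow_one (w x)]
        rw [← ENNReal.rpow_add _ _ (h.w0 x) (h.wt x)]
        congr 1
        field_simp
        ring
    _ ≤ A ^ (p / (p - 1)) * (C1 * (C2 * ∫⁻ x, (f x / s x) ^ p ∂(volume.withDensity s))) :=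
        mul_le_mul_right (mul_le_mul_right (H2 _ (hf.div h.hs)) _) _
    _ = A ^ (p / (p - 1)) * (C1 * (C2 * ∫⁻ x, f x ^ p * w x)) := by
        congr 3
        rw [lintegral_withDensity_eq_lintegral_mul (g := fun x => (f x / s x) ^ p) _ h.hs ((hf.div h.hs).pow_const _)]
        refine lintegral_congr fun x => ?_
        simp only [Pi.mul_apply]
        rw [ENNReal.div_rpow_of_nonneg _ _ hp0.le, div_eq_mul_inv, ← ENNReal.rpow_neg, h.rel' x,
          mul_left_comm]
        congr 1
        nth_rw 1 [← ENNReal.rpow_one (s x)]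
        rw [← ENNReal.rpow_add _ _ (h.s0 x) (h.st x)]
        congr 1
        ring
    _ = _ := by ring


/-- `b` has mean oscillation at most `D` on balls w.r.t. constants `av`. -/
def Osc (b : Rn n → ℝ) (av : Rn n → ℝ → ℝ) (D : ℝ) : Prop :=
  Measurable b ∧ 0 < D ∧ ∀ c r, 0 < r →
    ∫⁻ y in ball c r, ENNReal.ofReal |b y - av c r| ≤ ENNReal.ofReal D * volume (ball c r)

def lev (b : Rn n → ℝ) (av : Rn n → ℝ → ℝ) (c : Rn n) (r : ℝ) (t : ℝ) : Set (Rn n) :=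
  ball c r ∩ {x | t < |b x - av c r|}

lemma lev_meas {b : Rn n → ℝ} (hb : Measurable b) (av c r t) : MeasurableSet (lev b av c r t) :=
  measurableSet_ball.inter (measurableSet_lt measurable_const (by fun_prop))

lemma cheb {b : Rn n → ℝ} {av : Rn n → ℝ → ℝ} {D : ℝ} (h : Osc b av D) (c : Rn n) {r t : ℝ}
    (hr : 0 < r) (ht : 0 < t) :
    t * volume.real (lev b av c r t) ≤ D * volume.real (ball c r) := by
  obtain ⟨hb, hD, h⟩ := h
  have h1 := mul_meas_ge_le_lintegral₀ (μ := volume.restrict (ball c r))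
    (f := fun y => ENNReal.ofReal |b y - av c r|) (by fun_prop) (ENNReal.ofReal t)
  have h2 := h1.trans (h c r hr)
  have h3 : ENNReal.ofReal t * volume (lev b av c r t) ≤ ENNReal.ofReal D * volume (ball c r) := by
    refine le_trans ?_ h2
    refine mul_le_mul_right ?_ _
    rw [Measure.restrict_apply (measurableSet_le measurable_const (by fun_prop))]
    apply measure_mono
    rintro y ⟨hy1, hy2⟩
    exact ⟨ENNReal.ofReal_le_ofReal (le_of_lt hy2), hy1⟩
  have h4 := ENNReal.toReal_mono (ENNReal.mul_ne_top ENNReal.ofReal_ne_top (vol_fin c r)) h3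
  rw [ENNReal.toReal_mul, ENNReal.toReal_mul, ENNReal.toReal_ofReal ht.le,
    ENNReal.toReal_ofReal hD.le] at h4
  exact h4

lemma volr_mul (x y : Rn n) {k r : ℝ} (hk : 0 < k) :
    volume.real (ball x (k * r)) = k ^ n * volume.real (ball y r) := by
  rw [Measure.real, vol_mul x y hk, ENNReal.toReal_mul, ENNReal.toReal_ofReal (by positivity)]
  rfl

lemma volr_pos (x : Rn n) {r : ℝ} (hr : 0 < r) : 0 < volume.real (ball x r) :=
  ENNReal.toReal_pos (vol_pos x hr) (vol_fin x r)

lemma ball_inter {c x : Rn n} {r ρ : ℝ} (hρ : 0 < ρ) (h : ρ ≤ 2 * r) (hx : x ∈ ball c r) :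
    (1 / 4) ^ n * volume.real (ball x ρ) ≤ volume.real (ball x ρ ∩ ball c r) := by
  have hr : 0 < r := by linarith
  set t := ρ / (4 * r) with ht
  have ht0 : 0 < t := by positivity
  have ht1 : t ≤ 1 / 2 := by rw [ht, div_le_iff₀ (by positivity)]; linarith
  have htr : t * r = ρ / 4 := by rw [ht]; field_simp
  rw [mem_ball, dist_eq_norm] at hx
  rw [← volr_mul (x + t • (c - x)) x (by norm_num)]
  apply measureReal_mono _ (measure_ne_top_of_subset inter_subset_left (vol_fin _ _))
  intro y hy
  rw [mem_ball, dist_eq_norm] at hy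
  constructor
  · rw [mem_ball, dist_eq_norm]
    calc ‖y - x‖ = ‖(y - (x + t • (c - x))) + t • (c - x)‖ := by congr 1; abel
      _ ≤ ‖y - (x + t • (c - x))‖ + ‖t • (c - x)‖ := norm_add_le _ _
      _ < 1 / 4 * ρ + t * r := by
        rw [norm_smul, Real.norm_of_nonneg ht0.le, norm_sub_rev c x]
        nlinarith
      _ ≤ ρ := by linarith
  · rw [mem_ball, dist_eq_norm]
    calc ‖y - c‖ = ‖(y - (x + t • (c - x))) + (1 - t) • (x - c)‖ := by congr 1; module
      _ ≤ ‖y - (x + t • (c - x))‖ + ‖(1 - t) • (x - c)‖ := norm_add_le _ _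
      _ < 1 / 4 * ρ + (1 - t) * r := by
        rw [norm_smul, Real.norm_of_nonneg (by linarith)]
        nlinarith
      _ = r := by linarith

/-- selection of a stopping radius -/
lemma stop_radius {E : Set (Rn n)} {x : Rn n} {r θ : ℝ} (hr : 0 < r)
    (hθ : θ ≤ (1 / 2) ^ n / 2)
    (hd : Tendsto (fun r => volume (E ∩ closedBall x r) / volume (closedBall x r)) (𝓝[>] 0) (𝓝 1))
    (h0 : volume.real (E ∩ ball x r) ≤ θ * volume.real (ball x r)) :
    ∃ ρ, 0 < ρ ∧ 2 * ρ ≤ r ∧ θ * volume.real (ball x ρ) < volume.real (E ∩ ball x ρ) ∧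
      volume.real (E ∩ ball x (2 * ρ)) ≤ θ * volume.real (ball x (2 * ρ)) := by
  let R : ℕ → ℝ := fun m => r * (1 / 2) ^ m
  have hRpos : ∀ m, 0 < R m := fun m => by positivity
  have hRs : ∀ m, R (m + 1) = 1 / 2 * R m := fun m => by simp only [R]; ring
  have hR : Tendsto R atTop (𝓝[>] 0) := by
    rw [tendsto_nhdsWithin_iff]
    refine ⟨?_, Eventually.of_forall hRpos⟩
    have := (tendsto_pow_atTop_nhds_zero_of_lt_one (r := (1 / 2 : ℝ)) (by norm_num)
      (by norm_num)).const_mul r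
    rw [mul_zero] at this
    exact this
  have hfin : ∀ ρ, volume (E ∩ ball x ρ) ≠ ⊤ := fun ρ =>
    measure_ne_top_of_subset inter_subset_right (vol_fin x ρ)
  have hex : ∃ m, θ * volume.real (ball x (R m)) < volume.real (E ∩ ball x (R m)) := by
    have h1 := (hd.comp (hR.comp (tendsto_add_atTop_nat 1))).eventually
      (lt_mem_nhds (show (ENNReal.ofReal (1 / 2)) < 1 by
        rw [← ENNReal.ofReal_one]; exact (ENNReal.ofReal_lt_ofReal_iff one_pos).2 (by norm_num)))
    obtain ⟨m, hm⟩ := h1.exists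
    refine ⟨m, ?_⟩
    simp only [Function.comp] at hm
    have hv : volume (closedBall x (R (m + 1))) = volume (ball x (R (m + 1))) :=
      by
        rw [Measure.addHaar_closedBall _ _ (hRpos _).le, Measure.addHaar_ball_of_pos _ _ (hRpos _)]
    have hm2 : ENNReal.ofReal (1 / 2) * volume (ball x (R (m + 1))) <
        volume (E ∩ closedBall x (R (m + 1))) := by
      rw [← hv]
      exact ENNReal.mul_lt_of_lt_div hm
    have hsub : E ∩ closedBall x (R (m + 1)) ⊆ E ∩ ball x (R m) := by
      apply inter_subset_inter_right
      apply closedBall_subset_ball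
      rw [hRs]; linarith [hRpos m]
    have hm3 := hm2.trans_le (measure_mono hsub)
    have hm4 := ENNReal.toReal_strict_mono (hfin _) hm3
    rw [ENNReal.toReal_mul, ENNReal.toReal_ofReal (by norm_num)] at hm4
    change 1 / 2 * volume.real _ < volume.real _ at hm4
    rw [hRs, volr_mul x x (by norm_num)] at hm4
    have := volr_pos x (hRpos m)
    nlinarith
  classical
  have hsp := Nat.find_spec hex
  have hmn : Nat.find hex ≠ 0 := by
    intro h
    rw [h] at hsp
    simp only [R, pow_zero, mul_one] at hsp
    linarith
  obtain ⟨m, hm⟩ := Nat.exists_eq_succ_of_ne_zero hmn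
  have hmin := Nat.find_min hex (m := m) (by omega)
  rw [hm] at hsp
  refine ⟨R (m + 1), hRpos _, ?_, hsp, ?_⟩
  · rw [hRs]
    have : (1 / 2 : ℝ) ^ m ≤ 1 := pow_le_one₀ (by norm_num) (by norm_num)
    simp only [R]
    nlinarith
  · rw [hRs, show 2 * (1 / 2 * R m) = R m by ring]
    exact not_lt.1 hmin

lemma jn_local {b : Rn n → ℝ} {av : Rn n → ℝ → ℝ} {D : ℝ} (h : Osc b av D) :
    ∃ l : ℝ, 0 < l ∧ ∃ θ : ℝ, 0 < θ ∧ ∀ (c : Rn n) (r : ℝ), 0 < r → ∀ k : ℕ, 1 ≤ k →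
      ∀ᵐ x ∂(volume.restrict (lev b av c r (k * l))), ∃ ρ, 0 < ρ ∧
        θ * volume.real (ball x ρ) ≤
          volume.real (ball x ρ ∩ (lev b av c r (k * l) \ lev b av c r ((k + 1 : ℕ) * l))) := by
  have hD := h.2.1
  set a : ℝ := (1 / 4) ^ n with ha
  have ha0 : 0 < a := by positivity
  set θ : ℝ := a * (1 / 2) ^ n / 2 with hθ
  have hθ0 : 0 < θ := by positivity
  set l := 4 * D / a + 2 * D / θ with hl
  have hl0 : 0 < l := by positivity
  refine ⟨l, hl0, θ / 2, by positivity, ?_⟩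
  intro c r hr k hk
  set E := lev b av c r (k * l) with hE
  set E' := lev b av c r ((k + 1 : ℕ) * l) with hE'
  have hEm : MeasurableSet E := lev_meas h.1 _ _ _ _
  have hE'm : MeasurableSet E' := lev_meas h.1 _ _ _ _
  have hk1 : (1 : ℝ) ≤ k := by exact_mod_cast hk
  filter_upwards [Besicovitch.ae_tendsto_measure_inter_div volume E, ae_restrict_mem hEm] with x hx hxE
  have hxc : x ∈ ball c r := hxE.1
  obtain ⟨ρ, hρ, hρr, s1, s2⟩ := stop_radius (E := E) (x := x) (r := 2 * r) (θ := θ) (by positivity)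
    (by
      rw [hθ]
      have : a ≤ 1 := pow_le_one₀ (by norm_num) (by norm_num)
      have h2 : (0 : ℝ) < (1 / 2) ^ n := by positivity
      nlinarith) hx (by
      have h1 := cheb h c hr (t := k * l) (by positivity)
      have h2 : volume.real (E ∩ ball x (2 * r)) ≤ volume.real E :=
        measureReal_mono inter_subset_left (measure_ne_top_of_subset inter_subset_left (vol_fin c r))
      refine h2.trans ?_
      have h3 : volume.real (ball c r) ≤ volume.real (ball x (2 * r)) := by
        apply measureReal_mono _ (vol_fin _ _)
        apply ball_subset_ball'
        rw [mem_ball, dist_comm] at hxc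
        linarith
      have h4 : D ≤ θ * l := by
        rw [hl, mul_add, mul_div_cancel₀ _ hθ0.ne']
        have : 0 ≤ θ * (4 * D / a) := by positivity
        linarith
      have h5 : l * volume.real E ≤ D * volume.real (ball c r) := by
        refine le_trans ?_ h1
        have : 0 ≤ volume.real E := measureReal_nonneg
        have : l ≤ k * l := by nlinarith
        exact mul_le_mul_of_nonneg_right this measureReal_nonneg
      have h6 : 0 ≤ volume.real (ball c r) := measureReal_nonneg
      have h7 : l * volume.real E ≤ l * (θ * volume.real (ball x (2 * r))) := by
        calc _ ≤ _ := h5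
          _ ≤ (θ * l) * volume.real (ball x (2 * r)) := by gcongr
          _ = _ := by ring
      exact le_of_mul_le_mul_left h7 hl0)
  refine ⟨ρ, hρ, ?_⟩
  set V := volume.real (ball x ρ) with hV
  have hV0 : 0 < V := volr_pos x hρ
  have hfB : ∀ s : Set (Rn n), volume (ball x ρ ∩ s) ≠ ⊤ := fun s =>
    measure_ne_top_of_subset inter_subset_left (vol_fin x ρ)
  have e1 : volume.real (ball x ρ ∩ E) ≤ a / 2 * V := by
    calc _ ≤ volume.real (E ∩ ball x (2 * ρ)) := by
          apply measureReal_mono _ (measure_ne_top_of_subset inter_subset_right (vol_fin _ _))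
          rintro y ⟨h1, h2⟩
          exact ⟨h2, ball_subset_ball (by linarith) h1⟩
      _ ≤ _ := s2
      _ = a / 2 * V := by
          rw [volr_mul x x (by norm_num), hθ]
          have : (1 / 2 : ℝ) ^ n * 2 ^ n = 1 := by rw [← mul_pow]; norm_num
          linear_combination (a / 2 * V) * this
  have e2 : a / 2 * V ≤ volume.real ((ball x ρ ∩ ball c r) \ E) := by
    have h1 := ball_inter hρ (by linarith) hxc
    have h2 : volume.real (ball x ρ ∩ ball c r) ≤
        volume.real (ball x ρ ∩ E) + volume.real ((ball x ρ ∩ ball c r) \ E) := by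
      refine le_trans (measureReal_mono ?_ ?_) (measureReal_union_le _ _)
      · intro y hy
        by_cases hyE : y ∈ E
        · exact Or.inl ⟨hy.1, hyE⟩
        · exact Or.inr ⟨hy, hyE⟩
      · exact measure_ne_top_of_subset 
          (union_subset inter_subset_left (sdiff_subset.trans inter_subset_left)) (vol_fin x ρ)
    linarith
  have hfl : ∀ t, volume (lev b av x ρ t) ≠ ⊤ := fun t =>
    measure_ne_top_of_subset inter_subset_left (vol_fin x ρ)
  have e3 : |av x ρ - av c r| ≤ k * l + 4 * D / a := by
    by_contra hcon
    push Not at hcon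
    have h1 := cheb h x hρ (t := 4 * D / a) (by positivity)
    have h2 : volume.real ((ball x ρ ∩ ball c r) \ E) ≤ volume.real (lev b av x ρ (4 * D / a)) := by
      apply measureReal_mono _ (hfl _)
      rintro y ⟨⟨hy1, hy2⟩, hy3⟩
      refine ⟨hy1, ?_⟩
      have h3 : |b y - av c r| ≤ k * l := by
        by_contra h4
        exact hy3 ⟨hy2, not_le.1 h4⟩
      have h5 : |av x ρ - av c r| ≤ |b y - av x ρ| + |b y - av c r| := by
        rw [abs_sub_comm (b y) (av x ρ)]
        exact abs_sub_le _ _ _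
      show 4 * D / a < |b y - av x ρ|
      linarith
    have h3 : 4 * D / a * (a / 2 * V) ≤ D * V :=
      le_trans (mul_le_mul_of_nonneg_left (e2.trans h2) (by positivity)) h1
    have h4 : 4 * D / a * (a / 2 * V) = 2 * (D * V) := by field_simp; ring
    have : 0 < D * V := by positivity
    linarith
  have e4 : volume.real (ball x ρ ∩ E') ≤ θ / 2 * V := by
    have h1 := cheb h x hρ (t := 2 * D / θ) (by positivity)
    have h2 : volume.real (ball x ρ ∩ E') ≤ volume.real (lev b av x ρ (2 * D / θ)) := by
      apply measureReal_mono _ (hfl _)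
      rintro y ⟨hy1, hy2, hy3⟩
      refine ⟨hy1, ?_⟩
      have h5 : |b y - av c r| ≤ |b y - av x ρ| + |av x ρ - av c r| := abs_sub_le _ _ _
      change ((k + 1 : ℕ) : ℝ) * l < _ at hy3
      push_cast at hy3
      show 2 * D / θ < |b y - av x ρ|
      have : (k + 1 : ℝ) * l = k * l + (4 * D / a + 2 * D / θ) := by rw [← hl]; ring
      linarith
    have h3 : 2 * D / θ * volume.real (ball x ρ ∩ E') ≤ 2 * D / θ * (θ / 2 * V) := by
      calc _ ≤ _ := mul_le_mul_of_nonneg_left h2 (by positivity)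
        _ ≤ _ := h1
        _ = _ := by rw [← hV]; field_simp
    exact le_of_mul_le_mul_left h3 (by positivity)
  have e5 : volume.real (E ∩ ball x ρ) ≤
      volume.real (ball x ρ ∩ E') + volume.real (ball x ρ ∩ (E \ E')) := by
    refine le_trans (measureReal_mono ?_ ?_) (measureReal_union_le _ _)
    · intro y hy
      by_cases hyE : y ∈ E'
      · exact Or.inl ⟨hy.2, hyE⟩
      · exact Or.inr ⟨hy.2, hy.1, hyE⟩
    · exact measure_ne_top_of_subset 
          (union_subset inter_subset_left inter_subset_left) (vol_fin x ρ)
  linarith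


lemma jn_decay {b : Rn n → ℝ} {av : Rn n → ℝ → ℝ} {D : ℝ} (h : Osc b av D)
    {μ : Measure (Rn n)} (hμ : Good μ) :
    ∃ l : ℝ, 0 < l ∧ ∃ q : ℝ≥0∞, q < 1 ∧ ∀ (c : Rn n) (r : ℝ), 0 < r → ∀ k : ℕ,
      μ (lev b av c r ((k + 1 : ℕ) * l)) ≤ q ^ k * μ (ball c r) := by
  obtain ⟨l, hl, θ, hθ, H⟩ := jn_local h
  obtain ⟨CV, hCV, HV⟩ := hμ.vitali
  obtain ⟨hac, hfin, q, hq, K, hK, HK⟩ := hμ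
  set K' := K * (ENNReal.ofReal θ ^ q)⁻¹ with hK'
  have hθq0 : ENNReal.ofReal θ ^ q ≠ 0 := by
    rw [Ne, ENNReal.rpow_eq_zero_iff_of_pos hq]; simpa using hθ
  have hθqt : ENNReal.ofReal θ ^ q ≠ ⊤ := ENNReal.rpow_ne_top_of_nonneg hq.le ENNReal.ofReal_ne_top
  have hK't : K' ≠ ⊤ := ENNReal.mul_ne_top hK (ENNReal.inv_ne_top.2 hθq0)
  set η := CV * K' with hη
  have hηt : η ≠ ⊤ := ENNReal.mul_ne_top hCV hK't
  have hη1 : 1 + η ≠ ⊤ := ENNReal.add_ne_top.2 ⟨ENNReal.one_ne_top, hηt⟩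
  have hη0 : 1 + η ≠ 0 := by simp
  have step : ∀ (c : Rn n) (r : ℝ), 0 < r → ∀ k : ℕ, 1 ≤ k →
      μ (lev b av c r ((k + 1 : ℕ) * l)) ≤ η / (1 + η) * μ (lev b av c r (k * l)) := by
    intro c r hr k hk
    set E := lev b av c r (k * l) with hE
    set E' := lev b av c r ((k + 1 : ℕ) * l) with hE'
    have hEm : MeasurableSet E := lev_meas h.1 _ _ _ _
    have hE'm : MeasurableSet E' := lev_meas h.1 _ _ _ _
    have hsub : E' ⊆ E := by
      rintro x ⟨h1, h2⟩
      have h2' : ((k + 1 : ℕ) : ℝ) * l < |b x - av c r| := h2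
      refine ⟨h1, ?_⟩
      change (k : ℝ) * l < |b x - av c r|
      push_cast at h2'
      nlinarith
    have h1 := HV (K' • μ.restrict (E \ E')) {a : Rn n × ℝ | 0 < a.2 ∧
        θ * volume.real (ball a.1 a.2) ≤ volume.real (ball a.1 a.2 ∩ (E \ E'))}
      (fun a ha => ha.1) (by
        rintro ⟨x, ρ⟩ ⟨hρ, hx⟩
        simp only at hρ hx ⊢
        rw [Measure.smul_apply, Measure.restrict_apply measurableSet_ball, smul_eq_mul]
        have k1 := HK x ρ hρ (ball x ρ ∩ (E \ E')) (measurableSet_ball.inter (hEm.diff hE'm))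
          inter_subset_left
        have k2 : ENNReal.ofReal θ * volume (ball x ρ) ≤ volume (ball x ρ ∩ (E \ E')) := by
          rw [← ENNReal.ofReal_toReal (vol_fin x ρ), ← ENNReal.ofReal_mul hθ.le]
          exact ENNReal.ofReal_le_of_le_toReal hx
        have v0 : volume (ball x ρ) ^ q ≠ 0 := by
          rw [Ne, ENNReal.rpow_eq_zero_iff_of_pos hq]; exact vol_pos x hρ
        have vt : volume (ball x ρ) ^ q ≠ ⊤ := ENNReal.rpow_ne_top_of_nonneg hq.le (vol_fin x ρ)
        have k3 : ENNReal.ofReal θ ^ q * μ (ball x ρ) * volume (ball x ρ) ^ q ≤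
            K * μ (ball x ρ ∩ (E \ E')) * volume (ball x ρ) ^ q := by
          refine le_trans ?_ k1
          calc _ = (ENNReal.ofReal θ * volume (ball x ρ)) ^ q * μ (ball x ρ) := by
                rw [ENNReal.mul_rpow_of_nonneg _ _ hq.le]; ring
            _ ≤ _ := mul_le_mul_left (ENNReal.rpow_le_rpow k2 hq.le) _
        rw [ENNReal.mul_le_mul_iff_left v0 vt] at k3
        rw [← ENNReal.mul_le_mul_iff_right hθq0 hθqt]
        refine k3.trans (le_of_eq ?_)
        rw [hK']
        calc _ = (ENNReal.ofReal θ ^ q * (ENNReal.ofReal θ ^ q)⁻¹) * (K * μ (ball x ρ ∩ (E \ E'))) := by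
              rw [ENNReal.mul_inv_cancel hθq0 hθqt, one_mul]
          _ = _ := by ring)
    have h2 : μ E' ≤ η * μ (E \ E') := by
      rw [Measure.smul_apply, Measure.restrict_apply MeasurableSet.univ, univ_inter, smul_eq_mul,
        ← mul_assoc] at h1
      refine le_trans (measure_mono_ae ?_) h1
      have h3 := hac.ae_le (ae_imp_of_ae_restrict (H c r hr k hk))
      filter_upwards [h3] with x hx hxE'
      obtain ⟨ρ, hρ, hh⟩ := hx (hsub hxE')
      exact mem_biUnion (x := (x, ρ)) ⟨hρ, hh⟩ (mem_ball_self hρ)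
    have h3 : μ E = μ E' + μ (E \ E') := by
      rw [← measure_inter_add_sdiff E hE'm, inter_eq_right.2 hsub]
    rw [← ENNReal.mul_le_mul_iff_right hη0 hη1, ← mul_assoc, ENNReal.mul_div_cancel hη0 hη1, h3]
    calc (1 + η) * μ E' = μ E' + η * μ E' := by ring
      _ ≤ η * μ (E \ E') + η * μ E' := add_le_add_left h2 _
      _ = _ := by ring
  refine ⟨l, hl, η / (1 + η), ?_, ?_⟩
  · rw [ENNReal.div_lt_iff (Or.inl hη0) (Or.inl hη1), one_mul, add_comm]
    exact ENNReal.lt_add_right hηt one_ne_zero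
  intro c r hr k
  induction k with
  | zero =>
    rw [pow_zero, one_mul]
    exact measure_mono inter_subset_left
  | succ k ih =>
    calc _ ≤ _ := step c r hr (k + 1) (by omega)
      _ ≤ _ := mul_le_mul_right ih _
      _ = _ := by rw [pow_succ]; ring

lemma jn_exp {b : Rn n → ℝ} {av : Rn n → ℝ → ℝ} {D : ℝ} (h : Osc b av D)
    {μ : Measure (Rn n)} (hμ : Good μ) :
    ∃ δ : ℝ, 0 < δ ∧ ∃ C : ℝ≥0∞, C ≠ ⊤ ∧ ∀ δ', δ' ≤ δ → ∀ (c : Rn n) (r : ℝ), 0 < r →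
      ∫⁻ x in ball c r, ENNReal.ofReal (Real.exp (δ' * |b x - av c r|)) ∂μ ≤ C * μ (ball c r) := by
  obtain ⟨l, hl, q, hq, H⟩ := jn_decay h hμ
  have hqt : q ≠ ⊤ := (hq.trans ENNReal.one_lt_top).ne
  set Q : ℝ := (1 + q.toReal) / 2 with hQ
  have hq1 : q.toReal < 1 := by
    rw [← ENNReal.toReal_one]; exact ENNReal.toReal_strict_mono ENNReal.one_ne_top hq
  have hq0 : 0 ≤ q.toReal := ENNReal.toReal_nonneg
  have hQ0 : 0 < Q := by positivity
  have hQ1 : Q < 1 := by rw [hQ]; linarith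
  set δ : ℝ := Real.log Q⁻¹ / l with hδ
  have hδ0 : 0 < δ := div_pos (Real.log_pos ((one_lt_inv₀ hQ0).2 hQ1)) hl
  have hexp : Real.exp (δ * l) = Q⁻¹ := by
    rw [hδ, div_mul_cancel₀ _ hl.ne', Real.exp_log (by positivity)]
  set X : ℝ≥0∞ := ENNReal.ofReal (Real.exp (δ * l)) with hX
  have hXt : X ≠ ⊤ := ENNReal.ofReal_ne_top
  have hXq : X * q < 1 := by
    rw [hX, hexp, ← ENNReal.ofReal_toReal hqt, ← ENNReal.ofReal_mul (by positivity),
      ← ENNReal.ofReal_one]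
    rw [ENNReal.ofReal_lt_ofReal_iff one_pos, inv_mul_lt_iff₀ hQ0]
    rw [hQ]; linarith
  refine ⟨δ, hδ0, X + X ^ 2 * (1 - X * q)⁻¹, ?_, ?_⟩
  · refine ENNReal.add_ne_top.2 ⟨hXt, ENNReal.mul_ne_top (ENNReal.pow_ne_top hXt) ?_⟩
    rw [Ne, ENNReal.inv_eq_top]
    exact (tsub_pos_of_lt hXq).ne'
  intro δ' hδ' c r hr
  have hXk : ∀ k : ℕ, X ^ k = ENNReal.ofReal (Real.exp (δ * (k * l))) := by
    intro k
    rw [hX, ← ENNReal.ofReal_pow (Real.exp_pos _).le, ← Real.exp_nat_mul]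
    congr 2; ring
  have pw : ∀ x ∈ ball c r, ENNReal.ofReal (Real.exp (δ' * |b x - av c r|)) ≤
      X + ∑' k : ℕ, (lev b av c r ((k + 1 : ℕ) * l)).indicator (fun _ => X ^ (k + 2)) x := by
    intro x hx
    have h1 : ENNReal.ofReal (Real.exp (δ' * |b x - av c r|)) ≤
        ENNReal.ofReal (Real.exp (δ * |b x - av c r|)) := by
      gcongr
    refine h1.trans ?_
    rcases le_or_gt |b x - av c r| l with hle | hgt
    · refine le_trans ?_ le_self_add
      apply ENNReal.ofReal_le_ofReal
      gcongr
    · refine le_trans ?_ le_add_self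
      set t := |b x - av c r| with ht
      have hm1 : 1 < ⌈t / l⌉₊ := by
        rw [Nat.lt_ceil, Nat.cast_one, one_lt_div hl]; exact hgt
      obtain ⟨k, hk⟩ : ∃ k, ⌈t / l⌉₊ = k + 2 := ⟨⌈t / l⌉₊ - 2, by omega⟩
      refine le_trans ?_ (ENNReal.le_tsum k)
      have h2 : ((k + 1 : ℕ) : ℝ) < t / l := Nat.lt_ceil.1 (by omega)
      have h3 : t / l ≤ ((k + 2 : ℕ) : ℝ) := by rw [← hk]; exact Nat.le_ceil _
      rw [lt_div_iff₀ hl] at h2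
      rw [div_le_iff₀ hl] at h3
      rw [indicator_of_mem (show x ∈ lev b av c r ((k + 1 : ℕ) * l) from ⟨hx, h2⟩), hXk]
      apply ENNReal.ofReal_le_ofReal
      gcongr
  have hms : ∀ t, MeasurableSet (lev b av c r t) := fun t => lev_meas h.1 _ _ _ _
  calc _ ≤ ∫⁻ x in ball c r, (X + ∑' k : ℕ,
        (lev b av c r ((k + 1 : ℕ) * l)).indicator (fun _ => X ^ (k + 2)) x) ∂μ :=
        setLIntegral_mono' measurableSet_ball pw
    _ = X * μ (ball c r) + ∑' k : ℕ, X ^ (k + 2) * μ (lev b av c r ((k + 1 : ℕ) * l)) := by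
        rw [lintegral_add_left measurable_const, setLIntegral_const, lintegral_tsum]
        · congr 2
          ext k
          rw [lintegral_indicator_const (hms _), Measure.restrict_apply (hms _)]
          congr 2
          exact inter_eq_left.2 inter_subset_left
        · intro k
          exact (measurable_const.indicator (hms _)).aemeasurable
    _ ≤ X * μ (ball c r) + ∑' k : ℕ, (X ^ 2 * μ (ball c r)) * (X * q) ^ k := by
        refine add_le_add_right (ENNReal.tsum_le_tsum fun k => ?_) _
        calc _ ≤ _ := mul_le_mul_right (H c r hr k) _
          _ = _ := by rw [mul_pow, pow_add]; ring
    _ = _ := by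
        rw [ENNReal.tsum_mul_left, ENNReal.tsum_geometric]; ring


/-- exponential of a multiple of `b`. -/
def ex (b : Rn n → ℝ) (t : ℝ) (x : Rn n) : ℝ≥0∞ := ENNReal.ofReal (Real.exp (t * b x))

lemma ex_meas {b : Rn n → ℝ} (hb : Measurable b) (t : ℝ) : Measurable (ex b t) := by
  unfold ex; fun_prop

lemma ex_ne_zero (b : Rn n → ℝ) (t : ℝ) (x) : ex b t x ≠ 0 := by
  simp [ex, Real.exp_pos]

lemma ex_ne_top (b : Rn n → ℝ) (t : ℝ) (x) : ex b t x ≠ ⊤ := ENNReal.ofReal_ne_top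

lemma ex_rpow (b : Rn n → ℝ) (t u : ℝ) (x) : ex b t x ^ u = ex b (t * u) x := by
  unfold ex
  rw [ENNReal.ofReal_rpow_of_pos (Real.exp_pos _), ← Real.exp_mul]
  congr 2; ring

lemma ex_mul (b : Rn n → ℝ) (t u : ℝ) (x) : ex b t x * ex b u x = ex b (t + u) x := by
  unfold ex
  rw [← ENNReal.ofReal_mul (Real.exp_pos _).le, ← Real.exp_add]
  congr 2; ring

lemma ex_zero (b : Rn n → ℝ) (x) : ex b 0 x = 1 := by simp [ex]

lemma exp_int {b : Rn n → ℝ} {av : Rn n → ℝ → ℝ} {D : ℝ} (h : Osc b av D)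
    (hw : Measurable w) (hμ : Good (volume.withDensity w)) :
    ∃ δ : ℝ, 0 < δ ∧ ∃ C : ℝ≥0∞, C ≠ ⊤ ∧ ∀ t : ℝ, |t| ≤ δ → ∀ c r, 0 < r →
      ∫⁻ x in ball c r, ex b t x * w x ≤
        C * ENNReal.ofReal (Real.exp (t * av c r)) * ∫⁻ x in ball c r, w x := by
  obtain ⟨δ, hδ, C, hC, H⟩ := jn_exp h hμ
  refine ⟨δ, hδ, C, hC, fun t ht c r hr => ?_⟩
  have h1 := H |t| ht c r hr
  have hbm := h.1
  rw [setLIntegral_withDensity_eq_setLIntegral_mul _ hw (by fun_prop) measurableSet_ball,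
    withDensity_apply _ measurableSet_ball] at h1
  calc _ ≤ ∫⁻ x in ball c r, ENNReal.ofReal (Real.exp (t * av c r)) *
        (w * fun x => ENNReal.ofReal (Real.exp (|t| * |b x - av c r|))) x := by
        refine lintegral_mono fun x => ?_
        simp only [Pi.mul_apply]
        rw [mul_comm (w x), ← mul_assoc, ← ENNReal.ofReal_mul (Real.exp_pos _).le, ← Real.exp_add]
        refine mul_le_mul_left (ENNReal.ofReal_le_ofReal (Real.exp_le_exp.2 ?_)) _
        have := le_abs_self (t * (b x - av c r))
        rw [abs_mul] at this
        linarith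
    _ = ENNReal.ofReal (Real.exp (t * av c r)) * ∫⁻ x in ball c r,
        (w * fun x => ENNReal.ofReal (Real.exp (|t| * |b x - av c r|))) x := by
        rw [lintegral_const_mul']
        exact ENNReal.ofReal_ne_top
    _ ≤ ENNReal.ofReal (Real.exp (t * av c r)) * (C * ∫⁻ x in ball c r, w x) :=
        mul_le_mul_right h1 _
    _ = _ := by ring

lemma ApPair.exp (h : ApPair p A w s) {b : Rn n → ℝ} {av : Rn n → ℝ → ℝ} {D : ℝ}
    (hO : Osc b av D) : ∃ ε : ℝ, 0 < ε ∧ ∃ A' : ℝ≥0∞, ∀ t : ℝ, |t| ≤ ε →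
      ApPair p A' (fun x => ex b (t * p) x * w x) (fun x => ex b (t * p * (-(1 / (p - 1)))) x * s x) := by
  obtain ⟨δ, hδ, C, hC, H⟩ := exp_int hO h.hw h.good
  obtain ⟨δ', hδ', C', hC', H'⟩ := exp_int hO h.hs h.symm.good
  have hp := h.hp
  have hp1 : 0 < p - 1 := by linarith
  have hp0 : 0 < p := by linarith
  refine ⟨min (δ / p) (δ' * (p - 1) / p), by positivity, C * C' ^ (p - 1) * A, fun t ht => ?_⟩
  have ht1 : |t * p| ≤ δ := by
    have := ht.trans (min_le_left _ _)
    rw [abs_mul, abs_of_pos hp0]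
    rwa [le_div_iff₀ hp0] at this
  have ht2 : |t * p * (-(1 / (p - 1)))| ≤ δ' := by
    have := ht.trans (min_le_right _ _)
    rw [abs_mul, abs_mul, abs_of_pos hp0, abs_neg, abs_of_pos (by positivity : 0 < 1 / (p - 1)),
      mul_one_div, div_le_iff₀ hp1]
    rwa [le_div_iff₀ hp0] at this
  refine ⟨hp, ?_, (ex_meas hO.1 _).mul h.hw, (ex_meas hO.1 _).mul h.hs,
    fun x => mul_ne_zero (ex_ne_zero _ _ _) (h.w0 x),
    fun x => ENNReal.mul_ne_top (ex_ne_top _ _ _) (h.wt x), fun x => ?_, fun x r hr => ?_⟩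
  · exact ENNReal.mul_ne_top (ENNReal.mul_ne_top hC (ENNReal.rpow_ne_top_of_nonneg hp1.le hC')) h.hA
  · rw [ENNReal.mul_rpow_of_ne_zero (ex_ne_zero _ _ _) (h.w0 x), ex_rpow, ← h.rel]
  · calc _ ≤ (C * ENNReal.ofReal (Real.exp (t * p * av x r)) * ∫⁻ x in ball x r, w x) *
          (C' * ENNReal.ofReal (Real.exp (t * p * (-(1 / (p - 1))) * av x r)) *
            ∫⁻ x in ball x r, s x) ^ (p - 1) :=
          mul_le_mul' (H _ ht1 x r hr) (ENNReal.rpow_le_rpow (H' _ ht2 x r hr) hp1.le)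
      _ = C * C' ^ (p - 1) * ((∫⁻ x in ball x r, w x) * (∫⁻ x in ball x r, s x) ^ (p - 1)) *
          (ENNReal.ofReal (Real.exp (t * p * av x r)) *
          ENNReal.ofReal (Real.exp (t * p * (-(1 / (p - 1))) * av x r)) ^ (p - 1)) := by
          rw [ENNReal.mul_rpow_of_nonneg _ _ hp1.le, ENNReal.mul_rpow_of_nonneg _ _ hp1.le]; ring
      _ = C * C' ^ (p - 1) * ((∫⁻ x in ball x r, w x) * (∫⁻ x in ball x r, s x) ^ (p - 1)) := by
          rw [ENNReal.ofReal_rpow_of_pos (Real.exp_pos _), ← Real.exp_mul,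
            ← ENNReal.ofReal_mul (Real.exp_pos _).le, ← Real.exp_add]
          have : t * p * av x r + t * p * (-(1 / (p - 1))) * av x r * (p - 1) = 0 := by
            field_simp; ring
          rw [this, Real.exp_zero, ENNReal.ofReal_one, mul_one]
      _ ≤ _ := by
          rw [mul_assoc (C * C' ^ (p - 1))]
          exact mul_le_mul_right (h.ap x r hr) _

/-- `ENNReal` version of the maximal commutator. -/
def MB (b : Rn n → ℝ) (g : Rn n → ℝ≥0∞) (x : Rn n) : ℝ≥0∞ :=
  ⨆ (r : ℝ) (_ : 0 < r),
    (ENNReal.ofReal (r ^ n))⁻¹ * ∫⁻ y in ball x r, ENNReal.ofReal |b x - b y| * g y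

lemma abs_exp_bound {ε : ℝ} (hε : 0 < ε) (u : ℝ) :
    |u| ≤ 1 / ε * (Real.exp (ε * u) + Real.exp (-(ε * u))) := by
  rw [one_div, inv_mul_eq_div, le_div_iff₀ hε]
  have h1 := Real.add_one_le_exp (ε * u)
  have h2 := Real.add_one_le_exp (-(ε * u))
  have h3 := Real.exp_pos (ε * u)
  have h4 := Real.exp_pos (-(ε * u))
  rcases abs_cases u with ⟨h, _⟩ | ⟨h, _⟩ <;> rw [h] <;> nlinarith

lemma avg_le {g : Rn n → ℝ≥0∞} (x : Rn n) {r : ℝ} (hr : 0 < r) :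
    (ENNReal.ofReal (r ^ n))⁻¹ * ∫⁻ y in ball x r, g y ≤
      volume (ball (0 : Rn n) 1) * mx volume g x := by
  have h1 := le_mx volume g (c := x) hr (mem_ball_self hr)
  have h2 := vol_mul x (0 : Rn n) (r := 1) hr
  rw [mul_one] at h2
  refine le_trans (le_of_eq ?_) (mul_le_mul_right h1 _)
  have a0 : ENNReal.ofReal (r ^ n) ≠ 0 := by simpa using pow_pos hr n
  have v0 := vol_pos (0 : Rn n) one_pos
  have vt := vol_fin (0 : Rn n) 1
  rw [h2, ENNReal.div_eq_inv_mul, ENNReal.mul_inv (Or.inl a0) (Or.inl ENNReal.ofReal_ne_top)]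
  calc _ = (volume (ball (0 : Rn n) 1) * (volume (ball (0 : Rn n) 1))⁻¹) *
      ((ENNReal.ofReal (r ^ n))⁻¹ * ∫⁻ y in ball x r, g y) := by
        rw [ENNReal.mul_inv_cancel v0 vt, one_mul]
    _ = _ := by ring

lemma MB_le {b : Rn n → ℝ} (hb : Measurable b) {g : Rn n → ℝ≥0∞} (hg : Measurable g)
    {ε : ℝ} (hε : 0 < ε) (x : Rn n) :
    MB b g x ≤ ENNReal.ofReal (1 / ε) * volume (ball (0 : Rn n) 1) *
      (ex b ε x * mx volume (fun y => ex b (-ε) y * g y) x +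
        ex b (-ε) x * mx volume (fun y => ex b ε y * g y) x) := by
  refine iSup₂_le fun r hr => ?_
  have m1 : Measurable fun y => ex b (-ε) y * g y := (ex_meas hb _).mul hg
  have m2 : Measurable fun y => ex b ε y * g y := (ex_meas hb _).mul hg
  have h1 : ∫⁻ y in ball x r, ENNReal.ofReal |b x - b y| * g y ≤
      ENNReal.ofReal (1 / ε) * (ex b ε x * (∫⁻ y in ball x r, ex b (-ε) y * g y) +
        ex b (-ε) x * (∫⁻ y in ball x r, ex b ε y * g y)) := by
    rw [← lintegral_const_mul _ m1, ← lintegral_const_mul _ m2,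
      ← lintegral_add_left (m1.const_mul _), ← lintegral_const_mul']
    swap
    · exact ENNReal.ofReal_ne_top
    refine lintegral_mono fun y => ?_
    have : ENNReal.ofReal |b x - b y| ≤
        ENNReal.ofReal (1 / ε) * (ex b ε x * ex b (-ε) y + ex b (-ε) x * ex b ε y) := by
      unfold ex
      rw [← ENNReal.ofReal_mul (Real.exp_pos _).le, ← ENNReal.ofReal_mul (Real.exp_pos _).le,
        ← ENNReal.ofReal_add (by positivity) (by positivity), ← ENNReal.ofReal_mul (by positivity),
        ← Real.exp_add, ← Real.exp_add]
      refine ENNReal.ofReal_le_ofReal ((abs_exp_bound hε _).trans (le_of_eq ?_))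
      congr 3 <;> ring
    calc _ ≤ _ := mul_le_mul_left this _
      _ = _ := by ring
  calc _ ≤ _ := mul_le_mul_right h1 _
    _ = ENNReal.ofReal (1 / ε) *
      (ex b ε x * ((ENNReal.ofReal (r ^ n))⁻¹ * ∫⁻ y in ball x r, ex b (-ε) y * g y) +
        ex b (-ε) x * ((ENNReal.ofReal (r ^ n))⁻¹ * ∫⁻ y in ball x r, ex b ε y * g y)) := by ring
    _ ≤ ENNReal.ofReal (1 / ε) *
      (ex b ε x * (volume (ball (0 : Rn n) 1) * mx volume (fun y => ex b (-ε) y * g y) x) +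
        ex b (-ε) x * (volume (ball (0 : Rn n) 1) * mx volume (fun y => ex b ε y * g y) x)) :=
        mul_le_mul_right (add_le_add (mul_le_mul_right (avg_le x hr) _)
          (mul_le_mul_right (avg_le x hr) _)) _
    _ = _ := by ring

lemma MB_bound (h : ApPair p A w s) {b : Rn n → ℝ} {av : Rn n → ℝ → ℝ} {D : ℝ}
    (hO : Osc b av D) : ∃ C : ℝ≥0∞, C ≠ ⊤ ∧ ∀ g : Rn n → ℝ≥0∞, Measurable g →
      ∫⁻ x, MB b g x ^ p * w x ≤ C * ∫⁻ x, g x ^ p * w x := by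
  obtain ⟨ε, hε, A', H⟩ := h.exp hO
  have hp := h.hp
  have hp0 : 0 < p := by linarith
  have hb := hO.1
  obtain ⟨C1, hC1, H1⟩ := (H ε (abs_of_pos hε).le).muckenhoupt
  obtain ⟨C2, hC2, H2⟩ := (H (-ε) (by rw [abs_neg, abs_of_pos hε])).muckenhoupt
  set K := ENNReal.ofReal (1 / ε) * volume (ball (0 : Rn n) 1) with hK
  have hKt : K ≠ ⊤ := ENNReal.mul_ne_top ENNReal.ofReal_ne_top (vol_fin _ _)
  refine ⟨K ^ p * 2 ^ (p - 1) * (C1 + C2), ?_, fun g hg => ?_⟩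
  · refine ENNReal.mul_ne_top (ENNReal.mul_ne_top (ENNReal.rpow_ne_top_of_nonneg hp0.le hKt)
      (ENNReal.rpow_ne_top_of_nonneg (by linarith) (by simp))) (ENNReal.add_ne_top.2 ⟨hC1, hC2⟩)
  have cst : K ^ p * 2 ^ (p - 1) ≠ ⊤ := ENNReal.mul_ne_top (ENNReal.rpow_ne_top_of_nonneg hp0.le hKt)
      (ENNReal.rpow_ne_top_of_nonneg (by linarith) (by simp))
  have key : ∀ (t : ℝ) (C : ℝ≥0∞), (∀ f : Rn n → ℝ≥0∞, Measurable f →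
      ∫⁻ x, mx volume f x ^ p * (ex b (t * p) x * w x) ≤
        C * ∫⁻ x, f x ^ p * (ex b (t * p) x * w x)) →
      ∫⁻ x, (ex b t x * mx volume (fun y => ex b (-t) y * g y) x) ^ p * w x ≤
        C * ∫⁻ x, g x ^ p * w x := by
    intro t C hC
    have := hC (fun y => ex b (-t) y * g y) ((ex_meas hb _).mul hg)
    refine le_trans (le_of_eq ?_) (this.trans (le_of_eq ?_))
    · refine lintegral_congr fun x => ?_
      rw [ENNReal.mul_rpow_of_nonneg _ _ hp0.le, ex_rpow]; ring
    · congr 1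
      refine lintegral_congr fun x => ?_
      rw [ENNReal.mul_rpow_of_nonneg _ _ hp0.le, ex_rpow]
      calc _ = g x ^ p * w x * (ex b (-t * p) x * ex b (t * p) x) := by ring
        _ = _ := by rw [ex_mul, show -t * p + t * p = 0 by ring, ex_zero, mul_one]
  have k1 := key ε C1 H1
  have k2 := key (-ε) C2 H2
  rw [neg_neg] at k2
  have mm : Measurable fun x => (ex b ε x * mx volume (fun y => ex b (-ε) y * g y) x) ^ p * w x :=
    (((ex_meas hb _).mul (mx_meas _ _)).pow_const p).mul h.hw
  calc _ ≤ ∫⁻ x, K ^ p * 2 ^ (p - 1) *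
      ((ex b ε x * mx volume (fun y => ex b (-ε) y * g y) x) ^ p * w x +
        (ex b (-ε) x * mx volume (fun y => ex b ε y * g y) x) ^ p * w x) := by
        refine lintegral_mono fun x => ?_
        calc _ ≤ _ := mul_le_mul_left (ENNReal.rpow_le_rpow (MB_le hb hg hε x) hp0.le) _
          _ = K ^ p * (ex b ε x * mx volume (fun y => ex b (-ε) y * g y) x +
            ex b (-ε) x * mx volume (fun y => ex b ε y * g y) x) ^ p * w x := by
              rw [ENNReal.mul_rpow_of_nonneg _ _ hp0.le]
          _ ≤ _ := mul_le_mul_left (mul_le_mul_right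
              (ENNReal.rpow_add_le_mul_rpow_add_rpow _ _ hp.le) _) _
          _ = _ := by ring
    _ = K ^ p * 2 ^ (p - 1) *
      ((∫⁻ x, (ex b ε x * mx volume (fun y => ex b (-ε) y * g y) x) ^ p * w x) +
        ∫⁻ x, (ex b (-ε) x * mx volume (fun y => ex b ε y * g y) x) ^ p * w x) := by
        rw [lintegral_const_mul' _ _ cst, lintegral_add_left mm]
    _ ≤ _ := mul_le_mul_right (add_le_add k1 k2) _
    _ = _ := by ring


lemma ball_sub_cube (x : Rn n) (r : ℝ) : ball x r ⊆ cube x (2 * r) := by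
  intro y hy i
  have h1 : ‖y - x‖ < r := by rwa [← dist_eq_norm]
  have h2 := PiLp.norm_apply_le (y - x) i
  rw [PiLp.sub_apply, Real.norm_eq_abs] at h2
  linarith

lemma ap_pair (hp : 1 < p) {ω : Rn n → ℝ} (hω : IsAp n p ω) :
    ∃ (A : ℝ≥0∞) (w s : Rn n → ℝ≥0∞), ApPair p A w s ∧
      ∀ᵐ x : Rn n, w x = ENNReal.ofReal (ω x) := by
  obtain ⟨hpos, hloc, A, hA, H⟩ := hω
  have hp1 : 0 < p - 1 := by linarith
  have hp0 : 0 < p := by linarith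
  have hm := hloc.aestronglyMeasurable.aemeasurable
  set ω' := hm.mk ω with hω'
  have hω'm : Measurable ω' := hm.measurable_mk
  have hae : ω =ᵐ[volume] ω' := hm.ae_eq_mk
  set w : Rn n → ℝ≥0∞ := fun x => if 0 < ω' x then ENNReal.ofReal (ω' x) else 1 with hw
  have hwm : Measurable w :=
    Measurable.ite (measurableSet_lt measurable_const hω'm) (by fun_prop) measurable_const
  have e1 : ∀ᵐ x : Rn n, w x = ENNReal.ofReal (ω x) := by
    filter_upwards [hpos, hae] with x h1 h2
    rw [h2] at h1 ⊢
    simp [hw, h1]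
  have e2 : ∀ᵐ x : Rn n, w x ^ (-(1 / (p - 1))) = ENNReal.ofReal (ω x ^ (1 - p / (p - 1))) := by
    filter_upwards [hpos, e1] with x h1 h2
    rw [h2, ENNReal.ofReal_rpow_of_pos h1]
    congr 2
    field_simp
    ring
  set V := volume (ball (0 : Rn n) 1) with hV
  have v0 : V ≠ 0 := vol_pos (0 : Rn n) one_pos
  have vt : V ≠ ⊤ := vol_fin (0 : Rn n) 1
  refine ⟨A * (ENNReal.ofReal (2 ^ n) * V⁻¹) ^ p, w, fun x => w x ^ (-(1 / (p - 1))),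
    ⟨hp, ?_, hwm, hwm.pow_const _, ?_, ?_, fun x => rfl, ?_⟩, e1⟩
  · exact ENNReal.mul_ne_top hA (ENNReal.rpow_ne_top_of_nonneg hp0.le
      (ENNReal.mul_ne_top ENNReal.ofReal_ne_top (ENNReal.inv_ne_top.2 v0)))
  · intro x
    by_cases hx : 0 < ω' x <;> simp [hw, hx]
  · intro x
    by_cases hx : 0 < ω' x <;> simp [hw, hx]
  intro x r hr
  have h1 := H x (2 * r) (by linarith)
  set R := ENNReal.ofReal ((2 * r) ^ n) with hR
  have r0 : R ≠ 0 := by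
    have : 0 < (2 * r) ^ n := by positivity
    simpa [hR] using this
  have rt : R ≠ ⊤ := ENNReal.ofReal_ne_top
  rw [← lintegral_congr_ae (ae_restrict_of_ae e1), ← lintegral_congr_ae (ae_restrict_of_ae e2)] at h1
  set W := ∫⁻ x in cube x (2 * r), w x
  set S := ∫⁻ x in cube x (2 * r), w x ^ (-(1 / (p - 1)))
  have hRv : R = ENNReal.ofReal (2 ^ n) * V⁻¹ * volume (ball x r) := by
    have h2 := vol_mul x (0 : Rn n) (r := 1) hr
    rw [mul_one] at h2
    rw [h2, hR, mul_pow, ENNReal.ofReal_mul (by positivity)]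
    calc _ = ENNReal.ofReal (2 ^ n) * ENNReal.ofReal (r ^ n) * (V⁻¹ * V) := by
          rw [ENNReal.inv_mul_cancel v0 vt, mul_one]
      _ = _ := by ring
  have h2 : W * S ^ (p - 1) ≤ A * R ^ p := by
    calc W * S ^ (p - 1) = (W / R * R) * (S / R * R) ^ (p - 1) := by
          rw [ENNReal.div_mul_cancel r0 rt, ENNReal.div_mul_cancel r0 rt]
      _ = (W / R * (S / R) ^ (p - 1)) * (R * R ^ (p - 1)) := by
          rw [ENNReal.mul_rpow_of_nonneg _ _ hp1.le]; ring
      _ ≤ A * (R * R ^ (p - 1)) := mul_le_mul_left h1 _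
      _ = A * R ^ p := by
          congr 1
          nth_rw 1 [← ENNReal.rpow_one R]
          rw [← ENNReal.rpow_add _ _ r0 rt]
          congr 1; ring
  calc _ ≤ W * S ^ (p - 1) :=
        mul_le_mul' (lintegral_mono_set (ball_sub_cube x r))
          (ENNReal.rpow_le_rpow (lintegral_mono_set (ball_sub_cube x r)) hp1.le)
    _ ≤ _ := h2
    _ = _ := by rw [hRv, ENNReal.mul_rpow_of_nonneg _ _ hp0.le, mul_assoc]

lemma int_ball {b : Rn n → ℝ} (hb : LocallyIntegrable b volume) (c : Rn n) (r : ℝ) :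
    IntegrableOn b (ball c r) volume :=
  (hb.integrableOn_isCompact (isCompact_closedBall c r)).mono_set ball_subset_closedBall

lemma osc_lint {b : Rn n → ℝ} (hb : LocallyIntegrable b volume) (c : Rn n) {r : ℝ} (hr : 0 < r) :
    ∫⁻ y in ball c r, ENNReal.ofReal |b y - ⨍ y in ball c r, b y| =
      ENNReal.ofReal (oscBall b c r) * volume (ball c r) := by
  have hi : IntegrableOn (fun y => |b y - ⨍ y in ball c r, b y|) (ball c r) volume :=
    ((int_ball hb c r).sub (integrableOn_const (vol_fin c r))).abs
  have hv : 0 < volume.real (ball c r) := ENNReal.toReal_pos (vol_pos c hr) (vol_fin c r)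
  rw [← ofReal_integral_eq_lintegral_ofReal hi (Eventually.of_forall fun y => abs_nonneg _)]
  conv_rhs => rw [← ENNReal.ofReal_toReal (vol_fin c r)]
  rw [← ENNReal.ofReal_mul' ENNReal.toReal_nonneg]
  congr 1
  unfold oscBall
  rw [setAverage_eq volume (fun x => |b x - ⨍ y in ball c r, b y|), smul_eq_mul]
  change _ = (volume.real (ball c r))⁻¹ * _ * volume.real (ball c r)
  field_simp

lemma osc_of {b : Rn n → ℝ} (hb : IsBMO b) :
    ∃ (b' : Rn n → ℝ) (av : Rn n → ℝ → ℝ) (D : ℝ), Osc b' av D ∧ b =ᵐ[volume] b' := by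
  obtain ⟨hloc, C, hC⟩ := hb
  have hm := hloc.aestronglyMeasurable.aemeasurable
  refine ⟨hm.mk b, fun c r => ⨍ y in ball c r, b y, |C| + 1,
    ⟨hm.measurable_mk, by positivity, fun c r hr => ?_⟩, hm.ae_eq_mk⟩
  have : ∫⁻ y in ball c r, ENNReal.ofReal |hm.mk b y - ⨍ y in ball c r, b y| =
      ∫⁻ y in ball c r, ENNReal.ofReal |b y - ⨍ y in ball c r, b y| := by
    refine lintegral_congr_ae (ae_restrict_of_ae ?_)
    filter_upwards [hm.ae_eq_mk] with x hx
    rw [hx]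
  simp only
  rw [this, osc_lint hloc c hr]
  refine mul_le_mul_left (ENNReal.ofReal_le_ofReal ?_) _
  linarith [hC c r hr, le_abs_self C]

lemma osc_nonneg (b : Rn n → ℝ) (c : Rn n) (r : ℝ) : 0 ≤ oscBall b c r := by
  unfold oscBall
  rw [setAverage_eq volume (fun x => |b x - ⨍ y in ball c r, b y|), smul_eq_mul]
  exact mul_nonneg (by positivity) (integral_nonneg fun x => abs_nonneg _)

lemma osc_le {b : Rn n → ℝ} (hb : IsBMO b) (c : Rn n) {r : ℝ} (hr : 0 < r) :
    oscBall b c r ≤ bmoNorm b := by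
  obtain ⟨-, C, hC⟩ := hb
  have : Nonempty {r : ℝ // 0 < r} := ⟨⟨1, one_pos⟩⟩
  have b1 : ∀ c, BddAbove (range fun r : {r : ℝ // 0 < r} => oscBall b c r.1) := by
    rintro c
    refine ⟨C, ?_⟩
    rintro _ ⟨r, rfl⟩
    exact hC c r.1 r.2
  have b2 : BddAbove (range fun c : Rn n => ⨆ r : {r : ℝ // 0 < r}, oscBall b c r.1) := by
    refine ⟨C, ?_⟩
    rintro _ ⟨c, rfl⟩
    exact ciSup_le fun r => hC c r.1 r.2
  exact (le_ciSup (b1 c) ⟨r, hr⟩).trans (le_ciSup b2 c)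

lemma Mb_zero {b : Rn n → ℝ} (hb : IsBMO b) (h0 : bmoNorm b = 0) (f : Rn n → ℝ) :
    ∀ᵐ x : Rn n, Mb b f x = 0 := by
  have h1 : ∀ N : ℕ, ∀ᵐ y : Rn n, y ∈ ball (0 : Rn n) (N + 1) →
      b y = ⨍ y in ball (0 : Rn n) (N + 1), b y := by
    intro N
    have hN : (0 : ℝ) < N + 1 := by positivity
    have h2 := osc_lint hb.1 (0 : Rn n) hN
    have h3 : oscBall b (0 : Rn n) (N + 1) = 0 :=
      le_antisymm (h0 ▸ osc_le hb 0 hN) (osc_nonneg _ _ _)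
    rw [h3, ENNReal.ofReal_zero, zero_mul] at h2
    have hm := hb.1.aestronglyMeasurable.aemeasurable
    rw [lintegral_eq_zero_iff' (((hm.sub_const _).abs).ennreal_ofReal.restrict)] at h2
    refine ae_imp_of_ae_restrict ?_
    filter_upwards [h2] with y hy
    simp only [Pi.zero_apply, ENNReal.ofReal_eq_zero] at hy
    exact sub_eq_zero.1 (abs_nonpos_iff.1 hy)
  have h2 := ae_all_iff.2 h1
  filter_upwards [h2] with x hx
  refine le_antisymm (iSup₂_le fun r hr => ?_) bot_le
  obtain ⟨N, hN⟩ := exists_nat_gt (‖x‖ + r)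
  have hsub : ball x r ⊆ ball (0 : Rn n) (N + 1) := by
    refine ball_subset_ball' ?_
    rw [dist_zero_right]; linarith
  have : ∫⁻ y in ball x r, ENNReal.ofReal (|b x - b y| * |f y|) = ∫⁻ y in ball x r, 0 := by
    refine setLIntegral_congr_fun_ae measurableSet_ball ?_
    filter_upwards [h2] with y hy hyB
    rw [hx N (hsub (mem_ball_self hr)), hy N (hsub hyB)]
    simp
  rw [this]; simp

lemma main_bound (hp : 1 < p) {ω : Rn n → ℝ} (hω : IsAp n p ω) {b : Rn n → ℝ} (hb : IsBMO b) :
    ∃ C : ℝ≥0∞, C ≠ ⊤ ∧ ∀ f : Rn n → ℝ, MemLp f (ENNReal.ofReal p) (wMeasure n ω) →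
        wLpNorm p (wMeasure n ω) (Mb b f) ≤
          C * eLpNorm f (ENNReal.ofReal p) (wMeasure n ω) := by
  obtain ⟨A, w, s, hA, hw⟩ := ap_pair hp hω
  obtain ⟨b', av, D, hO, hbb⟩ := osc_of hb
  obtain ⟨C, hC, H⟩ := MB_bound hA hO
  have hp0 : 0 < p := by linarith
  have hμ : wMeasure n ω = volume.withDensity w :=
    withDensity_congr_ae (by filter_upwards [hw] with x hx using hx.symm)
  refine ⟨C ^ (1 / p), ENNReal.rpow_ne_top_of_nonneg (by positivity) hC, fun f hf => ?_⟩
  rw [hμ] at hf ⊢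
  have hac : (volume : Measure (Rn n)) ≪ volume.withDensity w :=
    withDensity_absolutelyContinuous' hA.hw.aemeasurable (Eventually.of_forall hA.w0)
  have hac' : volume.withDensity w ≪ (volume : Measure (Rn n)) :=
    withDensity_absolutelyContinuous _ _
  have hfm : AEMeasurable f volume := (hf.1.mono_ac hac).aemeasurable
  set g : Rn n → ℝ≥0∞ := fun x => ‖hfm.mk f x‖ₑ with hg
  have hgm : Measurable g := hfm.measurable_mk.enorm
  have hgf : ∀ᵐ x : Rn n, g x = ‖f x‖ₑ := by
    filter_upwards [hfm.ae_eq_mk] with x hx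
    rw [hg, hx]
  have hM : ∀ᵐ x : Rn n, Mb b f x = MB b' g x := by
    filter_upwards [hbb] with x hx
    unfold Mb MB
    refine iSup_congr fun r => iSup_congr fun hr => ?_
    congr 1
    refine lintegral_congr_ae (ae_restrict_of_ae ?_)
    filter_upwards [hbb, hgf] with y hy hgy
    rw [ENNReal.ofReal_mul (abs_nonneg _), hgy, hx, hy, Real.enorm_eq_ofReal_abs]
  unfold wLpNorm
  rw [eLpNorm_eq_lintegral_rpow_enorm_toReal (by simpa using hp0) ENNReal.ofReal_ne_top,
    ENNReal.toReal_ofReal hp0.le, ← ENNReal.mul_rpow_of_nonneg _ _ (by positivity)]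
  refine ENNReal.rpow_le_rpow ?_ (by positivity)
  have e1 : ∫⁻ x, Mb b f x ^ p ∂(volume.withDensity w) =
      ∫⁻ x, MB b' g x ^ p ∂(volume.withDensity w) := by
    refine lintegral_congr_ae (hac'.ae_le ?_)
    filter_upwards [hM] with x hx
    rw [hx]
  have e2 : ∫⁻ x, ‖f x‖ₑ ^ p ∂(volume.withDensity w) = ∫⁻ x, g x ^ p * w x := by
    rw [lintegral_withDensity_eq_lintegral_mul_non_measurable _ hA.hw
      (Eventually.of_forall fun x => (hA.wt x).lt_top)]
    refine lintegral_congr_ae ?_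
    filter_upwards [hgf] with x hx
    rw [Pi.mul_apply, hx, mul_comm]
  have e3 : ∫⁻ x, MB b' g x ^ p ∂(volume.withDensity w) = ∫⁻ x, MB b' g x ^ p * w x := by
    rw [lintegral_withDensity_eq_lintegral_mul_non_measurable _ hA.hw
      (Eventually.of_forall fun x => (hA.wt x).lt_top)]
    refine lintegral_congr fun x => ?_
    rw [Pi.mul_apply, mul_comm]
  rw [e1, e2, e3]
  exact H g hgm

lemma final (hp : 1 < p) (ω : Rn n → ℝ) (hω : IsAp n p ω)
    (b : Rn n → ℝ) (hb : IsBMO b) :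
    ∃ C : ℝ, 0 < C ∧
      ∀ f : Rn n → ℝ, MemLp f (ENNReal.ofReal p) (wMeasure n ω) →
        wLpNorm p (wMeasure n ω) (Mb b f) ≤
          ENNReal.ofReal (C * bmoNorm b) *
            eLpNorm f (ENNReal.ofReal p) (wMeasure n ω) := by
  have hp0 : 0 < p := by linarith
  have hnn : 0 ≤ bmoNorm b := (osc_nonneg b 0 1).trans (osc_le hb 0 one_pos)
  rcases hnn.eq_or_lt with h0 | h0
  · refine ⟨1, one_pos, fun f _ => ?_⟩
    have : ∫⁻ x, Mb b f x ^ p ∂(wMeasure n ω) = 0 := by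
      have hz : (fun x => Mb b f x ^ p) =ᵐ[wMeasure n ω] fun _ => 0 := by
        refine (withDensity_absolutelyContinuous _ _ : wMeasure n ω ≪ volume).ae_le ?_
        filter_upwards [Mb_zero hb h0.symm f] with x hx
        rw [hx, ENNReal.zero_rpow_of_pos hp0]
      rw [lintegral_congr_ae hz]; simp
    unfold wLpNorm
    rw [this, ENNReal.zero_rpow_of_pos (by positivity)]
    exact bot_le
  · obtain ⟨C, hC, H⟩ := main_bound hp hω hb
    refine ⟨C.toReal / bmoNorm b + 1, by positivity, fun f hf => (H f hf).trans ?_⟩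
    refine mul_le_mul_left ?_ _
    rw [add_mul, div_mul_cancel₀ _ h0.ne', one_mul]
    calc C = ENNReal.ofReal C.toReal := (ENNReal.ofReal_toReal hC).symm
      _ ≤ _ := ENNReal.ofReal_le_ofReal (by linarith)


end S15

/-- For `1 < p < ∞`, `ω ∈ A_p` and `b ∈ BMO(ℝⁿ)`, there is `C` such that
`‖M_b f‖_{L^p(ω)} ≤ C ‖b‖_BMO ‖f‖_{L^p(ω)}` for all `f ∈ L^p(ω)`, where
`M_b f(x) = sup_{r>0} r^{−n} ∫_{|x−y|<r} |b(x)−b(y)| |f(y)| dy`. -/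
theorem statement15 {n : ℕ} (p : ℝ) (hp : 1 < p)
    (ω : Rn n → ℝ) (hω : IsAp n p ω)
    (b : Rn n → ℝ) (hb : IsBMO b) :
    ∃ C : ℝ, 0 < C ∧
      ∀ f : Rn n → ℝ, MemLp f (ENNReal.ofReal p) (wMeasure n ω) →
        wLpNorm p (wMeasure n ω) (Mb b f) ≤
          ENNReal.ofReal (C * bmoNorm b) *
            eLpNorm f (ENNReal.ofReal p) (wMeasure n ω) := by
  exact S15.final hp ω hω b hb
end
end

section
/- Let K be a θ-type kernel on ℝⁿ and b ∈ L^∞(ℝⁿ). There is a constant C=C(n) such that for every ε ∈ (0,1/2], every h ∈ ℝⁿ with h ≠ 0, every locally integrable f and every x ∈ ℝⁿ: sup_{δ>0} |∫_{|x−y| > |h|/ε, |x+h−y| > δ} (K(x+h,y) − K(x,y)) (b(x+h)−b(y)) f(y) dy| ≤ C ‖b‖_∞ Mf(x) ∫₀^{2ε} θ(t)/t dt. -/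
open MeasureTheory Metric Filter Set
open scoped ENNReal Topology

noncomputable section

theorem aux_ball {n : ℕ} (f : Rn n → ℝ) (x : Rn n) (r : ℝ) (hr : 0 < r) :
    ∫⁻ y in ball x r, ENNReal.ofReal |f y| ≤
      ENNReal.ofReal (r ^ n) * volume (ball (0 : Rn n) 1) * maximal f x := by
  have hv : volume (ball x r) = ENNReal.ofReal (r ^ n) * volume (ball (0 : Rn n) 1) := by
    have := Measure.addHaar_ball_of_pos (volume : Measure (Rn n)) x hr
    simpa using this
  rw [← hv]
  have h0 : volume (ball x r) ≠ 0 := (measure_ball_pos _ _ hr).ne'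
  have ht : volume (ball x r) ≠ ⊤ := measure_ball_lt_top.ne
  calc ∫⁻ y in ball x r, ENNReal.ofReal |f y|
      = volume (ball x r) * ((volume (ball x r))⁻¹ * ∫⁻ y in ball x r, ENNReal.ofReal |f y|) := by
        rw [← mul_assoc, ENNReal.mul_inv_cancel h0 ht, one_mul]
    _ ≤ _ := by
        gcongr
        exact le_iSup₂ (f := fun (r : ℝ) (_ : 0 < r) =>
          (volume (ball x r))⁻¹ * ∫⁻ y in ball x r, ENNReal.ofReal |f y|) r hr

theorem aux_sum (θ : ℝ → ℝ) (hθ : IsModulus θ) (hD : DiniCondition θ) (ε : ℝ)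
    (hε : ε ∈ Ioc (0:ℝ) (1/2)) :
    ∑' k : ℕ, ENNReal.ofReal (θ (ε / 2 ^ k)) ≤
      2 * ENNReal.ofReal (∫ t in Ioc (0:ℝ) (2 * ε), θ t / t) := by
  obtain ⟨-, hmono, -, -, hnn⟩ := hθ
  obtain ⟨hε0, hε1⟩ := hε
  have hsub : Ioc (0:ℝ) (2 * ε) ⊆ Ioc (0:ℝ) 1 := Ioc_subset_Ioc le_rfl (by linarith)
  have hint : IntegrableOn (fun t => θ t / t) (Ioc (0:ℝ) (2 * ε)) := hD.mono_set hsub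
  rw [ofReal_integral_eq_lintegral_ofReal hint]
  swap
  · filter_upwards [ae_restrict_mem measurableSet_Ioc] with t ht
    have := hsub ht
    exact div_nonneg (hnn t ⟨this.1.le, this.2⟩) this.1.le
  let a : ℕ → ℝ := fun k => 2 * ε / 2 ^ k
  have ha : Antitone a := by
    intro i j hij
    exact div_le_div_of_nonneg_left (by linarith) (by positivity)
      (pow_le_pow_right₀ (by norm_num) hij)
  have hdis := ha.pairwise_disjoint_on_Ioc_succ
  have hsucc : ∀ k, a (Order.succ k) = ε / 2 ^ k := by
    intro k
    simp only [a, Nat.succ_eq_succ, Nat.succ_eq_add_one, pow_succ]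
    field_simp
  have hterm : ∀ k : ℕ, ENNReal.ofReal (θ (ε / 2 ^ k)) ≤
      2 * ∫⁻ t in Ioc (a (Order.succ k)) (a k), ENNReal.ofReal (θ t / t) := by
    intro k
    rw [hsucc]
    set s := ε / 2 ^ k with hs
    have hs0 : 0 < s := by positivity
    have hak : a k = 2 * s := by simp only [a, hs]; ring
    have hs1 : s ≤ 1 / 2 := (div_le_self hε0.le (one_le_pow₀ (by norm_num))).trans hε1
    rw [hak]
    have hθs : 0 ≤ θ s := hnn s ⟨hs0.le, by linarith⟩
    have : ∫⁻ t in Ioc s (2 * s), ENNReal.ofReal (θ s / (2 * s)) ≤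
        ∫⁻ t in Ioc s (2 * s), ENNReal.ofReal (θ t / t) := by
      refine setLIntegral_mono' measurableSet_Ioc fun t ht => ENNReal.ofReal_le_ofReal ?_
      have h1 : θ s ≤ θ t := hmono ⟨hs0.le, by linarith⟩
        ⟨by linarith [ht.1], by linarith [ht.2]⟩ ht.1.le
      exact div_le_div₀ (hθs.trans h1) h1 (hs0.trans ht.1) ht.2
    refine le_trans ?_ (mul_le_mul_right this 2)
    rw [setLIntegral_const, Real.volume_Ioc, ← ENNReal.ofReal_mul (by positivity),
      show (2 : ℝ≥0∞) = ENNReal.ofReal 2 by simp, ← ENNReal.ofReal_mul (by positivity)]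
    apply ENNReal.ofReal_le_ofReal
    apply le_of_eq
    field_simp
    ring
  calc _ ≤ ∑' k : ℕ, 2 * ∫⁻ t in Ioc (a (Order.succ k)) (a k), ENNReal.ofReal (θ t / t) :=
        ENNReal.tsum_le_tsum hterm
    _ = 2 * ∫⁻ t in ⋃ k, Ioc (a (Order.succ k)) (a k), ENNReal.ofReal (θ t / t) := by
        rw [ENNReal.tsum_mul_left, lintegral_iUnion (fun _ => measurableSet_Ioc) hdis]
    _ ≤ _ := by
        gcongr
        refine iUnion_subset fun k => Ioc_subset_Ioc ?_ ?_
        · rw [hsucc]; positivity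
        · simpa [a] using ha (Nat.zero_le k)

theorem statement18 (n : ℕ) :
    ∃ C : ℝ, 0 < C ∧
      ∀ θ : ℝ → ℝ, IsModulus θ → DiniCondition θ →
      ∀ C₀ : ℝ, ∀ K : Rn n → Rn n → ℝ, IsThetaKernel n θ C₀ K →
      ∀ (b : Rn n → ℝ) (B : ℝ), (∀ y, |b y| ≤ B) →
      ∀ ε : ℝ, ε ∈ Ioc (0:ℝ) (1/2) →
      ∀ h : Rn n, h ≠ 0 →
      ∀ f : Rn n → ℝ, LocallyIntegrable f volume →
      ∀ x : Rn n,
        (⨆ (δ : ℝ) (_ : 0 < δ), ENNReal.ofReal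
            |∫ y in {y : Rn n | ‖h‖ / ε < dist x y ∧ δ < dist (x + h) y},
              (K (x + h) y - K x y) * (b (x + h) - b y) * f y|) ≤
          ENNReal.ofReal (C * B * ∫ t in Ioc (0:ℝ) (2 * ε), θ t / t) *
            maximal f x := by
  set V : ℝ≥0∞ := volume (ball (0 : Rn n) 1) with hV
  have hVt : V ≠ ⊤ := measure_ball_lt_top.ne
  have hV0 : 0 < V.toReal := ENNReal.toReal_pos (measure_ball_pos _ _ one_pos).ne' hVt
  refine ⟨4 * 2 ^ n * V.toReal, by positivity, ?_⟩
  intro θ hθ hD C₀ K hK b B hb ε hε h hh f _ x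
  have hB : 0 ≤ B := (abs_nonneg _).trans (hb 0)
  have hh0 : 0 < ‖h‖ := norm_pos_iff.2 hh
  have hsum := aux_sum θ hθ hD ε hε
  obtain ⟨-, hmono, -, -, hnn⟩ := hθ
  have hε0 : 0 < ε := hε.1
  have hε1 : ε ≤ 1 / 2 := hε.2
  set r : ℝ := ‖h‖ / ε with hr
  have hr0 : 0 < r := by positivity
  have hhr : ‖h‖ = ε * r := by rw [hr]; field_simp
  set I : ℝ := ∫ t in Ioc (0:ℝ) (2 * ε), θ t / t with hI
  refine iSup₂_le fun δ _ => ?_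
  let A : ℕ → Set (Rn n) := fun k => {y | 2 ^ k * r ≤ dist x y ∧ dist x y < 2 ^ (k + 1) * r}
  have hAm : ∀ k, MeasurableSet (A k) := by
    intro k
    have hm : Measurable fun y : Rn n => dist x y := by fun_prop
    exact (measurableSet_le measurable_const hm).inter (measurableSet_lt hm measurable_const)
  have hcover : {y : Rn n | r < dist x y ∧ δ < dist (x + h) y} ⊆ ⋃ k, A k := by
    rintro y ⟨hy, -⟩
    obtain ⟨k, hk1, hk2⟩ := exists_nat_pow_near (x := dist x y / r) (y := 2)
      ((one_le_div hr0).2 hy.le) one_lt_two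
    exact mem_iUnion.2 ⟨k, (le_div_iff₀ hr0).1 hk1, (div_lt_iff₀ hr0).1 hk2⟩
  have hpt : ∀ k, ∀ y ∈ A k, ‖(K (x + h) y - K x y) * (b (x + h) - b y) * f y‖ₑ ≤
      ENNReal.ofReal (θ (ε / 2 ^ k) / (2 ^ k * r) ^ n * (2 * B)) * ENNReal.ofReal |f y| := by
    rintro k y ⟨hy1, hy2⟩
    have hp : (1 : ℝ) ≤ 2 ^ k := one_le_pow₀ (by norm_num)
    have hdr : r ≤ dist x y := le_trans (le_mul_of_one_le_left hr0.le hp) hy1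
    have hd0 : 0 < dist x y := hr0.trans_le hdr
    have hk := hK.2 x (x + h) y (dist_pos.1 hd0) (by
      rw [← dist_eq_norm x y, sub_add_cancel_left, norm_neg, hhr]; nlinarith)
    rw [← dist_eq_norm x y, sub_add_cancel_left, norm_neg] at hk
    have hle : ‖h‖ / dist x y ≤ ε / 2 ^ k := by
      rw [div_le_div_iff₀ hd0 (by positivity), hhr]; nlinarith
    have hle1 : ε / 2 ^ k ≤ 1 / 2 := (div_le_self hε0.le hp).trans hε1
    have hm : θ (‖h‖ / dist x y) ≤ θ (ε / 2 ^ k) :=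
      hmono ⟨by positivity, by linarith⟩ ⟨by positivity, by linarith⟩ hle
    have hn0 : 0 ≤ θ (ε / 2 ^ k) := hnn _ ⟨by positivity, by linarith⟩
    have hK1 : |K (x + h) y - K x y| ≤ θ (ε / 2 ^ k) / (2 ^ k * r) ^ n := by
      rw [abs_sub_comm]
      refine (le_trans (le_add_of_nonneg_right (abs_nonneg _)) hk).trans ?_
      exact div_le_div₀ hn0 hm (by positivity) (pow_le_pow_left₀ (by positivity) hy1 n)
    have hb1 : |b (x + h) - b y| ≤ 2 * B := by
      have := abs_sub (b (x + h)) (b y)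
      linarith [hb (x + h), hb y]
    rw [← ofReal_norm, ← ENNReal.ofReal_mul (by positivity), Real.norm_eq_abs, abs_mul,
      abs_mul]
    apply ENNReal.ofReal_le_ofReal
    gcongr
  have hterm : ∀ k, ∫⁻ y in A k, ‖(K (x + h) y - K x y) * (b (x + h) - b y) * f y‖ₑ ≤
      ENNReal.ofReal (θ (ε / 2 ^ k)) * (ENNReal.ofReal (2 * B * 2 ^ n) * V * maximal f x) := by
    intro k
    have hn0 : 0 ≤ θ (ε / 2 ^ k) := hnn _ ⟨by positivity, by
      have := (div_le_self hε0.le (one_le_pow₀ (M₀ := ℝ) (a := 2) (n := k) (by norm_num)))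
      linarith⟩
    calc _ ≤ ∫⁻ y in A k, ENNReal.ofReal (θ (ε / 2 ^ k) / (2 ^ k * r) ^ n * (2 * B)) *
            ENNReal.ofReal |f y| := setLIntegral_mono' (hAm k) (hpt k)
      _ = ENNReal.ofReal (θ (ε / 2 ^ k) / (2 ^ k * r) ^ n * (2 * B)) *
            ∫⁻ y in A k, ENNReal.ofReal |f y| := lintegral_const_mul' _ _ ENNReal.ofReal_ne_top
      _ ≤ ENNReal.ofReal (θ (ε / 2 ^ k) / (2 ^ k * r) ^ n * (2 * B)) *
            ∫⁻ y in ball x (2 ^ (k + 1) * r), ENNReal.ofReal |f y| := by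
          gcongr
          intro y hy
          rw [mem_ball']
          exact hy.2
      _ ≤ ENNReal.ofReal (θ (ε / 2 ^ k) / (2 ^ k * r) ^ n * (2 * B)) *
            (ENNReal.ofReal ((2 ^ (k + 1) * r) ^ n) * V * maximal f x) := by
          gcongr
          exact aux_ball f x _ (by positivity)
      _ = _ := by
          suffices hq : ENNReal.ofReal (θ (ε / 2 ^ k) / (2 ^ k * r) ^ n * (2 * B)) *
              ENNReal.ofReal ((2 ^ (k + 1) * r) ^ n) =
              ENNReal.ofReal (θ (ε / 2 ^ k)) * ENNReal.ofReal (2 * B * 2 ^ n) by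
            simp only [← mul_assoc] at hq ⊢
            rw [hq]
          rw [← ENNReal.ofReal_mul (by positivity), ← ENNReal.ofReal_mul hn0]
          congr 1
          rw [show (2 : ℝ) ^ (k + 1) * r = 2 * (2 ^ k * r) by ring, mul_pow 2 (2 ^ k * r)]
          have : (2 ^ k * r) ^ n ≠ 0 := by positivity
          generalize (2 ^ k * r) ^ n = q at *
          field_simp
  rw [← Real.norm_eq_abs, ofReal_norm]
  calc _ ≤ ∫⁻ y in {y : Rn n | r < dist x y ∧ δ < dist (x + h) y},
          ‖(K (x + h) y - K x y) * (b (x + h) - b y) * f y‖ₑ :=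
        enorm_integral_le_lintegral_enorm _
    _ ≤ ∫⁻ y in ⋃ k, A k, ‖(K (x + h) y - K x y) * (b (x + h) - b y) * f y‖ₑ :=
        lintegral_mono_set hcover
    _ ≤ ∑' k, ∫⁻ y in A k, ‖(K (x + h) y - K x y) * (b (x + h) - b y) * f y‖ₑ :=
        lintegral_iUnion_le _ _
    _ ≤ ∑' k, ENNReal.ofReal (θ (ε / 2 ^ k)) *
          (ENNReal.ofReal (2 * B * 2 ^ n) * V * maximal f x) := ENNReal.tsum_le_tsum hterm
    _ = (∑' k, ENNReal.ofReal (θ (ε / 2 ^ k))) *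
          (ENNReal.ofReal (2 * B * 2 ^ n) * V * maximal f x) := ENNReal.tsum_mul_right
    _ ≤ (2 * ENNReal.ofReal I) * (ENNReal.ofReal (2 * B * 2 ^ n) * V * maximal f x) := by
        gcongr
    _ = _ := by
        rw [show 4 * 2 ^ n * V.toReal * B * I = 2 * (2 * B * 2 ^ n) * V.toReal * I by ring,
          ENNReal.ofReal_mul (p := 2 * (2 * B * 2 ^ n) * V.toReal) (by positivity),
          ENNReal.ofReal_mul (p := 2 * (2 * B * 2 ^ n)) (by positivity),
          ENNReal.ofReal_mul (p := 2) (q := 2 * B * 2 ^ n) (by positivity),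
          ENNReal.ofReal_toReal hVt]
        simp only [ENNReal.ofReal_ofNat]
        ring
end
end

section
/- Let n ≥ 1, 1 < r < ∞, and set r′ = r/(r−1). There is a constant C=C(n) such that for every ε ∈ (0,1/4), every locally r-integrable function f on ℝⁿ and every x ∈ ℝⁿ: sup_{δ>0} ∫_{δ/(1+ε) < |y| < δ} |f(x−y)| |y|^{−n} dy ≤ C ε^{1/r′} (1+ε)^{n/r} ( M(|f|^r)(x) )^{1/r}. -/
open MeasureTheory Metric Filter Set
open scoped ENNReal Topology

noncomputable section

lemma annulus_vol {n : ℕ} (hn : 1 ≤ n) {ε δ : ℝ} (hε : 0 < ε) (hε1 : ε < 1) (hδ : 0 < δ) :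
    volume {y : Rn n | δ / (1 + ε) < ‖y‖ ∧ ‖y‖ < δ} ≤
      ENNReal.ofReal (δ ^ n * (volume (ball (0 : Rn n) 1)).toReal * (n * ε)) := by
  haveI : NeZero n := ⟨by omega⟩
  haveI : Nontrivial (Rn n) := inferInstanceAs (Nontrivial (EuclideanSpace ℝ (Fin n)))
  have hV : volume (ball (0 : Rn n) 1) ≠ ⊤ := measure_ball_lt_top.ne
  set v := (volume (ball (0 : Rn n) 1)).toReal with hv
  have hVv : volume (ball (0 : Rn n) 1) = ENNReal.ofReal v := (ENNReal.ofReal_toReal hV).symm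
  have hA : {y : Rn n | δ / (1 + ε) < ‖y‖ ∧ ‖y‖ < δ} = ball 0 δ \ closedBall 0 (δ / (1 + ε)) := by
    ext y; simp [and_comm]
  have h1 : 0 < 1 + ε := by linarith
  have hsub : closedBall (0 : Rn n) (δ / (1 + ε)) ⊆ ball 0 δ := by
    apply closedBall_subset_ball
    rw [div_lt_iff₀ h1]; nlinarith
  have hv0 : 0 ≤ v := ENNReal.toReal_nonneg
  rw [hA, measure_sdiff hsub measurableSet_closedBall.nullMeasurableSet measure_closedBall_lt_top.ne,
    Measure.addHaar_ball _ _ hδ.le, Measure.addHaar_closedBall _ _ (by positivity), hVv,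
    ← ENNReal.ofReal_mul (by positivity), ← ENNReal.ofReal_mul (by positivity),
    ← ENNReal.ofReal_sub _ (by positivity)]
  apply ENNReal.ofReal_le_ofReal
  simp only [finrank_euclideanSpace, Fintype.card_fin]
  have hb : 1 - n * ε ≤ (1 / (1 + ε)) ^ n := by
    have h2 : 1 - ε ≤ 1 / (1 + ε) := by
      rw [le_div_iff₀ h1]; nlinarith
    have h3 : (1 - ε) ^ n ≤ (1 / (1 + ε)) ^ n := pow_le_pow_left₀ (by linarith) h2 n
    have h4 := one_add_mul_le_pow (a := -ε) (by linarith) n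
    have h5 : 1 + -ε = 1 - ε := by ring
    rw [h5] at h4
    linarith
  have h6 : (δ / (1 + ε)) ^ n = δ ^ n * (1 / (1 + ε)) ^ n := by rw [← mul_pow]; congr 1; ring
  rw [h6]
  have h7 : 0 ≤ δ ^ n * v := by positivity
  nlinarith [mul_le_mul_of_nonneg_left hb h7]

theorem statement19 (n : ℕ) (hn : 1 ≤ n) :
    ∃ C : ℝ, 0 < C ∧
      ∀ r : ℝ, 1 < r →
      ∀ ε : ℝ, ε ∈ Ioo (0:ℝ) (1/4) →
      ∀ f : Rn n → ℝ, LocallyIntegrable (fun y => |f y| ^ r) volume →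
      ∀ x : Rn n,
        (⨆ (δ : ℝ) (_ : 0 < δ),
            ∫⁻ y in {y : Rn n | δ / (1 + ε) < ‖y‖ ∧ ‖y‖ < δ},
              ENNReal.ofReal (|f (x - y)| / ‖y‖ ^ n)) ≤
          ENNReal.ofReal (C * ε ^ (1 / (r / (r - 1))) * (1 + ε) ^ ((n : ℝ) / r)) *
            (maximal (fun y => |f y| ^ r) x) ^ (1 / r) := by
  haveI : NeZero n := ⟨by omega⟩
  haveI : Nontrivial (Rn n) := inferInstanceAs (Nontrivial (EuclideanSpace ℝ (Fin n)))
  have hV : volume (ball (0 : Rn n) 1) ≠ ⊤ := measure_ball_lt_top.ne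
  have hV0 : volume (ball (0 : Rn n) 1) ≠ 0 := (measure_ball_pos _ _ one_pos).ne'
  obtain ⟨v, hv⟩ : ∃ v, v = (volume (ball (0 : Rn n) 1)).toReal := ⟨_, rfl⟩
  have hVv : volume (ball (0 : Rn n) 1) = ENNReal.ofReal v := by
    rw [hv]; exact (ENNReal.ofReal_toReal hV).symm
  have hv0 : 0 < v := by rw [hv]; exact ENNReal.toReal_pos hV0 hV
  have hn1 : (1 : ℝ) ≤ n := by exact_mod_cast hn
  refine ⟨2 ^ n * v * n, by positivity, ?_⟩
  intro r hr ε ⟨hε, hε4⟩ f hf x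
  refine iSup₂_le fun δ hδ => ?_
  have h1 : 0 < 1 + ε := by linarith
  have hr0 : 0 < r := by linarith
  set A : Set (Rn n) := {y : Rn n | δ / (1 + ε) < ‖y‖ ∧ ‖y‖ < δ} with hA
  have hAm : MeasurableSet A :=
    (measurableSet_lt measurable_const measurable_norm).inter
      (measurableSet_lt measurable_norm measurable_const)
  set q := r / (r - 1) with hq
  have hpq : r.HolderConjugate q := Real.HolderConjugate.conjExponent hr
  set F : Rn n → ℝ≥0∞ := fun z => ENNReal.ofReal |f z| with hF
  have hFm : AEMeasurable F volume := by
    have h := hf.aestronglyMeasurable.aemeasurable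
    have h2 : AEMeasurable (fun y => (|f y| ^ r) ^ (1 / r)) volume := h.pow_const _
    refine (h2.congr (ae_of_all _ fun y => ?_)).ennreal_ofReal
    simp only
    rw [← Real.rpow_mul (abs_nonneg _), mul_one_div_cancel hr0.ne', Real.rpow_one]
  have hFxm : AEMeasurable (fun y => F (x - y)) (volume.restrict A) :=
    (hFm.comp_quasiMeasurePreserving
      (quasiMeasurePreserving_sub_left_of_right_invariant volume x)).restrict
  set M := maximal (fun y => |f y| ^ r) x with hM
  set B := volume (ball x δ) with hB
  have hBv : B = ENNReal.ofReal (δ ^ n * v) := by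
    rw [hB, Measure.addHaar_ball _ _ hδ.le, hVv, ← ENNReal.ofReal_mul (by positivity)]
    simp
  have hB0 : B ≠ 0 := (measure_ball_pos _ _ hδ).ne'
  have hBt : B ≠ ⊤ := measure_ball_lt_top.ne
  have hFr : ∀ z, F z ^ r = ENNReal.ofReal |(|f z| ^ r)| := fun z => by
    rw [abs_of_nonneg (Real.rpow_nonneg (abs_nonneg (f z)) r)]
    exact ENNReal.ofReal_rpow_of_nonneg (abs_nonneg _) hr0.le
  have hI : ∫⁻ y in A, F (x - y) ^ r ≤ B * M := by
    have e1 : ∫⁻ y in A, F (x - y) ^ r ≤ ∫⁻ z in ball x δ, F z ^ r := by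
      rw [← lintegral_indicator hAm, ← lintegral_indicator measurableSet_ball,
        ← lintegral_sub_left_eq_self ((ball x δ).indicator fun z => F z ^ r) x]
      refine lintegral_mono fun y => ?_
      by_cases hy : y ∈ A
      · have : x - y ∈ ball x δ := by
          simpa [mem_ball, dist_eq_norm] using hy.2
        simp [hy, this]
      · simp [hy]
    have e2 : B⁻¹ * ∫⁻ z in ball x δ, F z ^ r ≤ M := by
      simp only [hFr]
      exact le_iSup₂ (f := fun (r' : ℝ) (_ : 0 < r') => (volume (ball x r'))⁻¹ *
        ∫⁻ y in ball x r', ENNReal.ofReal |(|f y| ^ r)|) δ hδ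
    refine e1.trans ?_
    rwa [ENNReal.inv_mul_le_iff hB0 hBt] at e2
  have hvol : volume A ≤ B * ENNReal.ofReal (n * ε) := by
    rw [hBv, ← ENNReal.ofReal_mul (by positivity), hv]
    exact annulus_vol hn hε (by linarith) hδ
  have hH : ∫⁻ y in A, F (x - y) ≤ (B * M) ^ (1 / r) * (B * ENNReal.ofReal (n * ε)) ^ (1 / q) := by
    have := ENNReal.lintegral_mul_le_Lp_mul_Lq (volume.restrict A) hpq hFxm
      (aemeasurable_const (b := (1 : ℝ≥0∞)))
    simp only [Pi.mul_apply, mul_one, ENNReal.one_rpow, lintegral_const, one_mul,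
      Measure.restrict_apply MeasurableSet.univ, univ_inter] at this
    refine this.trans ?_
    have := hpq.symm.pos
    gcongr
  have hq0 := hpq.symm.pos
  have hsum : 1 / r + 1 / q = 1 := by
    have := hpq.inv_add_inv_eq_one
    simpa [one_div] using this
  have hpt : ∫⁻ y in A, ENNReal.ofReal (|f (x - y)| / ‖y‖ ^ n) ≤
      ENNReal.ofReal (((1 + ε) / δ) ^ n) * ∫⁻ y in A, F (x - y) := by
    rw [← lintegral_const_mul' _ _ ENNReal.ofReal_ne_top]
    refine setLIntegral_mono' hAm fun y hy => ?_
    rw [hF, ← ENNReal.ofReal_mul (by positivity)]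
    apply ENNReal.ofReal_le_ofReal
    have : 0 < δ / (1 + ε) := by positivity
    have h2 : ((1 + ε) / δ) ^ n = ((δ / (1 + ε)) ^ n)⁻¹ := by
      rw [← inv_pow, inv_div]
    rw [h2, div_eq_mul_inv, mul_comm]
    gcongr
    exact hy.1.le
  refine hpt.trans ?_
  calc _ ≤ ENNReal.ofReal (((1 + ε) / δ) ^ n) *
        ((B * M) ^ (1 / r) * (B * ENNReal.ofReal (n * ε)) ^ (1 / q)) := by gcongr
    _ = (ENNReal.ofReal (((1 + ε) / δ) ^ n) * B * ENNReal.ofReal ((n * ε) ^ (1 / q))) *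
        M ^ (1 / r) := by
      rw [ENNReal.mul_rpow_of_nonneg _ _ (by positivity),
        ENNReal.mul_rpow_of_nonneg _ _ (by positivity),
        ENNReal.ofReal_rpow_of_nonneg (by positivity) (by positivity)]
      have : B = B ^ (1 / r) * B ^ (1 / q) := by
        rw [← ENNReal.rpow_add _ _ hB0 hBt, hsum, ENNReal.rpow_one]
      conv_rhs => rw [this]
      ring
    _ ≤ _ := by
      gcongr
      rw [hBv, ← ENNReal.ofReal_mul (by positivity), ← ENNReal.ofReal_mul (by positivity)]
      apply ENNReal.ofReal_le_ofReal
      have e1 : ((1 + ε) / δ) ^ n * (δ ^ n * v) = (1 + ε) ^ n * v := by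
        rw [div_pow]; field_simp
      rw [e1, Real.mul_rpow (by positivity) hε.le]
      have e2 : (n : ℝ) ^ (1 / q) ≤ n := by
        have h3 : 1 / q ≤ 1 := by
          have : 0 < 1 / r := by positivity
          linarith
        simpa using Real.rpow_le_rpow_of_exponent_le hn1 h3
      have e3 : (1 : ℝ) ≤ (1 + ε) ^ ((n : ℝ) / r) :=
        Real.one_le_rpow (by linarith) (by positivity)
      have e4 : (1 + ε) ^ n ≤ 2 ^ n := pow_le_pow_left₀ h1.le (by linarith) n
      calc (1 + ε) ^ n * v * ((n : ℝ) ^ (1 / q) * ε ^ (1 / q))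
          ≤ 2 ^ n * v * (n * ε ^ (1 / q)) := by gcongr
        _ = 2 ^ n * v * n * ε ^ (1 / q) * 1 := by ring
        _ ≤ _ := by gcongr
end
end
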